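/- arXiv:2307.08772 — 8 statements merged into one kernel-verified Lean document; each statement's English description precedes it below -/
import Mathlib

section
/- Let H be a bipartite graph with parts A and B', let k, K be positive integers, and let t assign a nonnegative integer weight t_e to each edge e of H such that t(u) ≤ k for every u ∈ A and t(v) ≤ K for every v ∈ B', where t(w) = Σ_{e incident to w} t_e. Let N be a matching in H such that every edge (u,v) ∈ N with u ∈ A and v ∈ B' satisfies t(u) = k or t(v) = K. Then Σ_{e∈E(H)} t_e ≥ (kK/(k+K)) · |N|. -/
/-- In a bipartite graph with parts `α` and `β` and edge set `E ⊆ α × β`,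
`N` is a matching: a set of edges that are pairwise vertex-disjoint. -/
def IsBipMatching {α β : Type*} (E N : Finset (α × β)) : Prop :=
  N ⊆ E ∧ ∀ e ∈ N, ∀ f ∈ N, e ≠ f → e.1 ≠ f.1 ∧ e.2 ≠ f.2

theorem fiber_count_aux {α γ : Type*} [DecidableEq γ] (E M : Finset α) (g : α → γ) (t : α → ℕ)
    (c : ℕ) (hinj : ∀ e ∈ M, ∀ f ∈ M, g e = g f → e = f)
    (h : ∀ e ∈ M, ∑ f ∈ E.filter (fun f => g f = g e), t f = c) :
    c * M.card ≤ ∑ e ∈ E, t e := by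
  calc c * M.card = ∑ e ∈ M, ∑ f ∈ E.filter (fun f => g f = g e), t f := by
        rw [Finset.sum_congr rfl h]; simp [mul_comm]
    _ = ∑ f ∈ E, ∑ e ∈ M, (if g f = g e then t f else 0) := by
        simp_rw [Finset.sum_filter]
        exact Finset.sum_comm
    _ ≤ ∑ f ∈ E, t f := by
        apply Finset.sum_le_sum
        intro f _
        rw [← Finset.sum_filter, Finset.sum_const, smul_eq_mul]
        have h1 : (M.filter (fun e => g f = g e)).card ≤ 1 := by
          rw [Finset.card_le_one]
          intro a ha b hb
          simp only [Finset.mem_filter] at ha hb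
          exact hinj a ha.1 b hb.1 (ha.2.symm.trans hb.2)
        nlinarith

/-- Bipartite graph with edge set `E`, positive integer capacities `k, K`, nonnegative integer
edge weights `t` with `t(u) ≤ k` for all `u ∈ A` and `t(v) ≤ K` for all `v ∈ B'`.
If `N` is a matching such that each `(u,v) ∈ N` satisfies `t(u) = k` or `t(v) = K`, then
`Σ_{e∈E} t_e ≥ (kK/(k+K))·|N|`. -/
theorem stmt2 {α β : Type*} [DecidableEq α] [DecidableEq β]
    (E : Finset (α × β)) (k K : ℕ) (hk : 0 < k) (hK : 0 < K)
    (t : α × β → ℕ)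
    (hA : ∀ u : α, ∑ f ∈ E.filter (fun f => f.1 = u), t f ≤ k)
    (hB : ∀ v : β, ∑ f ∈ E.filter (fun f => f.2 = v), t f ≤ K)
    (N : Finset (α × β)) (hN : IsBipMatching E N)
    (hsat : ∀ e ∈ N, (∑ f ∈ E.filter (fun f => f.1 = e.1), t f = k) ∨
                     (∑ f ∈ E.filter (fun f => f.2 = e.2), t f = K)) :
    (∑ e ∈ E, (t e : ℝ)) ≥ ((k : ℝ) * K / (k + K)) * N.card := by
  have h1 := fiber_count_aux E
    (N.filter (fun e => ∑ f ∈ E.filter (fun f => f.1 = e.1), t f = k)) Prod.fst t k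
    (by
      intro e he f hf hef
      by_contra hne
      exact (hN.2 e (Finset.mem_filter.1 he).1 f (Finset.mem_filter.1 hf).1 hne).1 hef)
    (fun e he => (Finset.mem_filter.1 he).2)
  have h2 := fiber_count_aux E
    (N.filter (fun e => ¬ ∑ f ∈ E.filter (fun f => f.1 = e.1), t f = k)) Prod.snd t K
    (by
      intro e he f hf hef
      by_contra hne
      exact (hN.2 e (Finset.mem_filter.1 he).1 f (Finset.mem_filter.1 hf).1 hne).2 hef)
    (fun e he => (hsat e (Finset.mem_filter.1 he).1).resolve_left (Finset.mem_filter.1 he).2)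
  have h3 := Finset.card_filter_add_card_filter_not (s := N)
    (fun e => ∑ f ∈ E.filter (fun f => f.1 = e.1), t f = k)
  generalize (N.filter (fun e => ∑ f ∈ E.filter (fun f => f.1 = e.1), t f = k)).card = a at h1 h3
  generalize (N.filter (fun e => ¬ ∑ f ∈ E.filter (fun f => f.1 = e.1), t f = k)).card = b at h2 h3
  rw [← h3, ← Nat.cast_sum]
  generalize ∑ e ∈ E, t e = T at h1 h2
  have h1' : (k : ℝ) * a ≤ T := by exact_mod_cast h1
  have h2' : (K : ℝ) * b ≤ T := by exact_mod_cast h2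
  have hk' : (0 : ℝ) < k := by exact_mod_cast hk
  have hK' : (0 : ℝ) < K := by exact_mod_cast hK
  push_cast
  rw [ge_iff_le, div_mul_eq_mul_div, div_le_iff₀ (by positivity)]
  nlinarith [mul_le_mul_of_nonneg_left h1' hK'.le, mul_le_mul_of_nonneg_left h2' hk'.le]
end

section
/- Let H be a bipartite graph with parts A and B', let k, K be positive integers, let 0 ≤ δ < 1, and let t assign a nonnegative integer weight t_e to each edge e of H such that t(u) ≤ k for every u ∈ A and t(v) ≤ K for every v ∈ B', where t(w) = Σ_{e incident to w} t_e. Let N be a matching in H, and let X be the number of edges (u,v) ∈ N with u ∈ A and v ∈ B' satisfying t(u) ≥ (1−δ)k or t(v) ≥ (1−δ)K. Then Σ_{e∈E(H)} t_e ≥ (1−δ) · (kK/(k+K)) · X. -/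
/-- Summing over disjoint fibres. -/
lemma fiber_bound {ι γ : Type*} [DecidableEq ι] [DecidableEq γ] (E M : Finset ι) (g : ι → γ)
    (t : ι → ℕ) (c : ℝ) (hinj : ∀ e ∈ M, ∀ f ∈ M, e ≠ f → g e ≠ g f)
    (hc : ∀ e ∈ M, c ≤ ∑ f ∈ E.filter (fun f => g f = g e), (t f : ℝ)) :
    c * (M.card : ℝ) ≤ ∑ e ∈ E, (t e : ℝ) := by
  have h1 : c * (M.card : ℝ) ≤ ∑ e ∈ M, ∑ f ∈ E.filter (fun f => g f = g e), (t f : ℝ) := by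
    have := Finset.card_nsmul_le_sum M _ c hc
    rw [nsmul_eq_mul] at this
    linarith
  refine h1.trans ?_
  rw [← Finset.sum_biUnion]
  · apply Finset.sum_le_sum_of_subset_of_nonneg
    · intro x hx
      simp only [Finset.mem_biUnion, Finset.mem_filter] at hx
      obtain ⟨_, _, h, _⟩ := hx
      exact h
    · intros
      positivity
  · intro e he f hf hef
    rw [Function.onFun, Finset.disjoint_left]
    intro x hx hy
    simp only [Finset.mem_filter] at hx hy
    exact hinj e he f hf hef (hx.2.symm.trans hy.2)

/-- Bipartite graph with edge set `E`, positive integer capacities `k, K`, `0 ≤ δ < 1`, and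
nonnegative integer edge weights `t` with `t(u) ≤ k` for `u ∈ A` and `t(v) ≤ K` for `v ∈ B'`.
If `N` is a matching and `X` is the number of edges `(u,v) ∈ N` with `t(u) ≥ (1−δ)k`
or `t(v) ≥ (1−δ)K`, then `Σ_{e∈E} t_e ≥ (1−δ)·(kK/(k+K))·X`. -/
theorem stmt3 {α β : Type*} [DecidableEq α] [DecidableEq β]
    (E : Finset (α × β)) (k K : ℕ) (hk : 0 < k) (hK : 0 < K)
    (δ : ℝ) (hδ0 : 0 ≤ δ) (hδ1 : δ < 1)
    (t : α × β → ℕ)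
    (hA : ∀ u : α, ∑ f ∈ E.filter (fun f => f.1 = u), t f ≤ k)
    (hB : ∀ v : β, ∑ f ∈ E.filter (fun f => f.2 = v), t f ≤ K)
    (N : Finset (α × β)) (hN : IsBipMatching E N)
    (X : ℕ)
    (hX : X = (N.filter (fun e =>
        ((1 - δ) * k ≤ (∑ f ∈ E.filter (fun f => f.1 = e.1), t f : ℝ)) ∨
        ((1 - δ) * K ≤ (∑ f ∈ E.filter (fun f => f.2 = e.2), t f : ℝ)))).card) :
    (∑ e ∈ E, (t e : ℝ)) ≥ (1 - δ) * ((k : ℝ) * K / (k + K)) * X := by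
  obtain ⟨-, hM⟩ := hN
  rw [Finset.filter_or] at hX
  have hcard := Finset.card_union_le (N.filter (fun e =>
        ((1 - δ) * k ≤ (∑ f ∈ E.filter (fun f => f.1 = e.1), t f : ℝ)))) (N.filter (fun e =>
        ((1 - δ) * K ≤ (∑ f ∈ E.filter (fun f => f.2 = e.2), t f : ℝ))))
  rw [← hX] at hcard
  have ha := fiber_bound E (N.filter (fun e =>
        ((1 - δ) * k ≤ (∑ f ∈ E.filter (fun f => f.1 = e.1), t f : ℝ)))) Prod.fst t ((1 - δ) * k)
    (fun e he f hf hef => (hM e (Finset.mem_filter.1 he).1 f (Finset.mem_filter.1 hf).1 hef).1)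
    (fun e he => (Finset.mem_filter.1 he).2)
  have hb := fiber_bound E (N.filter (fun e =>
        ((1 - δ) * K ≤ (∑ f ∈ E.filter (fun f => f.2 = e.2), t f : ℝ)))) Prod.snd t ((1 - δ) * K)
    (fun e he f hf hef => (hM e (Finset.mem_filter.1 he).1 f (Finset.mem_filter.1 hf).1 hef).2)
    (fun e he => (Finset.mem_filter.1 he).2)
  generalize (N.filter (fun e =>
        ((1 - δ) * k ≤ (∑ f ∈ E.filter (fun f => f.1 = e.1), t f : ℝ)))).card = a at *
  generalize (N.filter (fun e =>
        ((1 - δ) * K ≤ (∑ f ∈ E.filter (fun f => f.2 = e.2), t f : ℝ)))).card = b at *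
  generalize (∑ e ∈ E, (t e : ℝ)) = S at *
  have hX' : (X : ℝ) ≤ a + b := by exact_mod_cast hcard
  have hk' : (0 : ℝ) < k := by exact_mod_cast hk
  have hK' : (0 : ℝ) < K := by exact_mod_cast hK
  have h3 : (1 - δ) * ((k : ℝ) * K / (k + K)) * X = (1 - δ) * k * K * X / (k + K) := by ring
  rw [ge_iff_le, h3, div_le_iff₀ (by positivity)]
  have h4 := mul_le_mul_of_nonneg_right ha hK'.le
  have h5 := mul_le_mul_of_nonneg_right hb hk'.le
  have hd : 0 ≤ (1 - δ) * k * K := by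
    have : 0 ≤ 1 - δ := by linarith
    positivity
  have h6 := mul_le_mul_of_nonneg_left hX' hd
  linarith
end

section
/- Let ε > 0, let G be a graph, and let x be a fractional matching on G such that for every vertex set S ⊆ V(G) with |S| < 1/ε, the blossom inequality Σ_{e∈G[S]} x_e ≤ ⌊|S|/2⌋ holds, where G[S] denotes the set of edges of G with both endpoints in S. Then μ(G) ≥ (1−ε) · Σ_{e∈E(G)} x_e, where μ(G) denotes the maximum size of a matching in G. -/
/-- `N` is a matching of the simple graph `G`: a set of edges of `G` that are
pairwise vertex-disjoint. -/
def IsMatching {V : Type*} (G : SimpleGraph V) (N : Finset (Sym2 V)) : Prop :=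
  (∀ e ∈ N, e ∈ G.edgeSet) ∧
    ∀ e ∈ N, ∀ f ∈ N, e ≠ f → ∀ v : V, v ∈ e → v ∉ f

/-- `x` is a fractional matching of `G`: every edge gets a weight in `[0,1]` and
the total weight of the edges incident to any vertex is at most `1`. -/
def IsFracMatching {V : Type*} [Fintype V] [DecidableEq V] (G : SimpleGraph V)
    [DecidableRel G.Adj] (x : Sym2 V → ℝ) : Prop :=
  (∀ e ∈ G.edgeFinset, 0 ≤ x e ∧ x e ≤ 1) ∧
    ∀ v : V, ∑ e ∈ G.edgeFinset.filter (fun e => v ∈ e), x e ≤ 1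

open Finset in
/-- Half-size bound on the weight inside a vertex set. -/
lemma frac_half {V : Type*} [Fintype V] [DecidableEq V] (G : SimpleGraph V)
    [DecidableRel G.Adj] (x : Sym2 V → ℝ) (hx : IsFracMatching G x) (S : Finset V) :
    ∑ e ∈ G.edgeFinset.filter (fun e => ∀ v ∈ e, v ∈ S), x e ≤ (S.card : ℝ) / 2 := by
  have h1 : ∑ v ∈ S, ∑ e ∈ G.edgeFinset.filter (fun e => v ∈ e), x e ≤ ∑ v ∈ S, (1 : ℝ) :=
    Finset.sum_le_sum fun v _ => hx.2 v
  have h2 : ∑ v ∈ S, ∑ e ∈ G.edgeFinset.filter (fun e => v ∈ e), x e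
      = ∑ e ∈ G.edgeFinset, ∑ v ∈ S, if v ∈ e then x e else 0 := by
    simp_rw [Finset.sum_filter]
    exact Finset.sum_comm
  have h3 : ∑ e ∈ G.edgeFinset, (if ∀ v ∈ e, v ∈ S then 2 * x e else 0)
      ≤ ∑ e ∈ G.edgeFinset, ∑ v ∈ S, if v ∈ e then x e else 0 := by
    refine Finset.sum_le_sum fun e he => ?_
    have hnn := (hx.1 e he).1
    split_ifs with h
    · have hd : ¬ e.IsDiag := G.not_isDiag_of_mem_edgeFinset he
      have hc := Sym2.card_toFinset_of_not_isDiag e hd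
      rw [← Finset.sum_filter, Finset.sum_const, nsmul_eq_mul]
      have : S.filter (fun v => v ∈ e) = e.toFinset := by
        ext v
        simp only [Finset.mem_filter, Sym2.mem_toFinset]
        exact ⟨fun h => h.2, fun hv => ⟨h v hv, hv⟩⟩
      rw [this, hc]
      norm_num
    · exact Finset.sum_nonneg fun v _ => by split_ifs <;> simp [hnn]
  have h4 : ∑ e ∈ G.edgeFinset, (if ∀ v ∈ e, v ∈ S then 2 * x e else 0)
      = 2 * ∑ e ∈ G.edgeFinset.filter (fun e => ∀ v ∈ e, v ∈ S), x e := by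
    rw [← Finset.sum_filter, Finset.mul_sum]
  simp only [Finset.sum_const, nsmul_eq_mul, mul_one] at h1
  linarith

/-- Weak duality: an odd-set cover bounds the fractional value. -/
lemma frac_cover {V : Type*} [Fintype V] [DecidableEq V]
    (ε : ℝ) (hε : 0 < ε) (hε1 : ε < 1) (G : SimpleGraph V) [DecidableRel G.Adj]
    (x : Sym2 V → ℝ) (hx : IsFracMatching G x)
    (hblossom : ∀ S : Finset V, (S.card : ℝ) < 1 / ε →
      ∑ e ∈ G.edgeFinset.filter (fun e => ∀ v ∈ e, v ∈ S), x e ≤ ((S.card / 2 : ℕ) : ℝ))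
    {κ : Type*} [Fintype κ] (U : Finset V) (S : κ → Finset V)
    (hc : ∀ e ∈ G.edgeFinset, (∃ u ∈ U, u ∈ e) ∨ ∃ c, ∀ v ∈ e, v ∈ S c) :
    (1 - ε) * ∑ e ∈ G.edgeFinset, x e ≤ U.card + ∑ c, (((S c).card / 2 : ℕ) : ℝ) := by
  have h1 : ∑ e ∈ G.edgeFinset, x e ≤
      ∑ u ∈ U, ∑ e ∈ G.edgeFinset.filter (fun e => u ∈ e), x e
      + ∑ c, ∑ e ∈ G.edgeFinset.filter (fun e => ∀ v ∈ e, v ∈ S c), x e := by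
    simp_rw [Finset.sum_filter]
    rw [Finset.sum_comm, Finset.sum_comm (s := (Finset.univ : Finset κ)),
      ← Finset.sum_add_distrib]
    refine Finset.sum_le_sum fun e he => ?_
    have hnn := (hx.1 e he).1
    have p1 : ∀ u ∈ U, 0 ≤ (if u ∈ e then x e else 0) :=
      fun u _ => by split_ifs <;> simp [hnn]
    have p2 : ∀ c ∈ (Finset.univ : Finset κ), 0 ≤ (if ∀ v ∈ e, v ∈ S c then x e else 0) :=
      fun u _ => by split_ifs <;> simp [hnn]
    have q1 := Finset.sum_nonneg p1
    have q2 := Finset.sum_nonneg p2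
    rcases hc e he with ⟨u, hu, hue⟩ | ⟨c, hcc⟩
    · have := Finset.single_le_sum p1 hu
      rw [if_pos hue] at this
      linarith
    · have := Finset.single_le_sum p2 (Finset.mem_univ c)
      rw [if_pos hcc] at this
      linarith
  have h2 : ∑ u ∈ U, ∑ e ∈ G.edgeFinset.filter (fun e => u ∈ e), x e ≤ U.card := by
    calc _ ≤ ∑ u ∈ U, (1 : ℝ) := Finset.sum_le_sum fun v _ => hx.2 v
      _ = _ := by simp
  have h3 : (1 - ε) * ∑ c, ∑ e ∈ G.edgeFinset.filter (fun e => ∀ v ∈ e, v ∈ S c), x e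
      ≤ ∑ c, (((S c).card / 2 : ℕ) : ℝ) := by
    rw [Finset.mul_sum]
    refine Finset.sum_le_sum fun c _ => ?_
    by_cases hs : ((S c).card : ℝ) < 1 / ε
    · have hb := hblossom (S c) hs
      have hn : (0 : ℝ) ≤ ((S c).card / 2 : ℕ) := Nat.cast_nonneg _
      nlinarith
    · have hb := frac_half G x hx (S c)
      push Not at hs
      rw [div_le_iff₀ hε] at hs
      have hn : ((S c).card : ℝ) ≤ 2 * ((S c).card / 2 : ℕ) + 1 := by
        have : (S c).card ≤ 2 * ((S c).card / 2) + 1 := by omega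
        exact_mod_cast this
      nlinarith
  have hU : (0 : ℝ) ≤ U.card := Nat.cast_nonneg _
  nlinarith [mul_le_mul_of_nonneg_left h1 (by linarith : (0 : ℝ) ≤ 1 - ε)]

/-- Number of odd components after deleting `u`. -/
noncomputable def oddc {V : Type*} (G : SimpleGraph V) (u : Set V) : ℕ :=
  ((⊤ : G.Subgraph).deleteVerts u).coe.oddComponents.ncard

/-- `G` with `d` extra universal vertices. -/
def addUniv {V : Type*} (G : SimpleGraph V) (d : ℕ) : SimpleGraph (V ⊕ Fin d) where
  Adj a b := a ≠ b ∧ ∀ u v, a = Sum.inl u → b = Sum.inl v → G.Adj u v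
  symm := ⟨fun _ _ h => ⟨h.1.symm, fun u v hu hv => (h.2 v u hv hu).symm⟩⟩
  loopless := ⟨fun _ h => h.1 rfl⟩

lemma addUniv_inl {V : Type*} (G : SimpleGraph V) (d : ℕ) (u v : V) :
    (addUniv G d).Adj (Sum.inl u) (Sum.inl v) ↔ G.Adj u v := by
  constructor
  · intro h
    exact h.2 u v rfl rfl
  · intro h
    refine ⟨fun e => h.ne (Sum.inl_injective e), ?_⟩
    intro a b ha hb
    rw [← Sum.inl_injective ha, ← Sum.inl_injective hb]
    exact h

lemma oddComponents_iso {V W : Type*} {G : SimpleGraph V} {H : SimpleGraph W} (φ : G ≃g H) :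
    G.oddComponents.ncard = H.oddComponents.ncard := by
  have key : ∀ c : G.ConnectedComponent,
      c.supp.ncard = (φ.connectedComponentEquiv c).supp.ncard := fun c =>
    Nat.card_congr (SimpleGraph.ConnectedComponent.isoEquivSupp φ c)
  refine Nat.card_congr (φ.connectedComponentEquiv.subtypeEquiv fun c => ?_)
  change Odd _ ↔ Odd _
  rw [key c]

lemma oddc_parity {V : Type*} [Finite V] (G : SimpleGraph V) (u : Set V) :
    (oddc G u + u.ncard) % 2 = Nat.card V % 2 := by
  have h := SimpleGraph.odd_ncard_oddComponents (G := ((⊤ : G.Subgraph).deleteVerts u).coe)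
  have h2 : Nat.card ((⊤ : G.Subgraph).deleteVerts u).verts + u.ncard = Nat.card V := by
    rw [Nat.card_coe_set_eq]
    simp only [SimpleGraph.Subgraph.deleteVerts_verts, SimpleGraph.Subgraph.verts_top]
    rw [← Set.compl_eq_univ_sdiff, add_comm, Set.ncard_add_ncard_compl]
  change Odd (oddc G u) ↔ _ at h
  rw [← h2]
  simp only [Nat.odd_iff] at h
  omega

lemma oddc_addUniv_all {V : Type*} (G : SimpleGraph V) (d : ℕ) (W : Set (V ⊕ Fin d))
    (hW : ∀ i, Sum.inr i ∈ W) : oddc (addUniv G d) W = oddc G (Sum.inl ⁻¹' W) := by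
  symm
  refine oddComponents_iso ⟨Equiv.ofBijective
    (fun v => ⟨Sum.inl v.1, by have := v.2; simp at this; simpa using this⟩) ⟨?_, ?_⟩, ?_⟩
  · intro a b h
    exact Subtype.ext (Sum.inl_injective (congrArg Subtype.val h))
  · rintro ⟨v | i, hv⟩
    · exact ⟨⟨v, by simpa using hv⟩, rfl⟩
    · exact absurd (hW i) (by simpa using hv)
  · rintro ⟨a, ha⟩ ⟨b, hb⟩
    have ha' : Sum.inl a ∉ W := by simpa using ha
    have hb' : Sum.inl b ∉ W := by simpa using hb
    simp only [SimpleGraph.Subgraph.coe_adj, SimpleGraph.Subgraph.deleteVerts_adj,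
      SimpleGraph.Subgraph.top_adj, SimpleGraph.Subgraph.verts_top, Set.mem_univ, true_and]
    change (Sum.inl a ∉ W ∧ Sum.inl b ∉ W ∧ (addUniv G d).Adj (Sum.inl a) (Sum.inl b)) ↔
      (Sum.inl a ∉ W ∧ Sum.inl b ∉ W ∧ G.Adj a b)
    rw [addUniv_inl]

lemma oddc_addUniv_not {V : Type*} [Finite V] (G : SimpleGraph V) (d : ℕ) (W : Set (V ⊕ Fin d))
    (i : Fin d) (hi : Sum.inr i ∉ W) : oddc (addUniv G d) W ≤ 1 := by
  set K := ((⊤ : (addUniv G d).Subgraph).deleteVerts W).coe with hK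
  have hz : Sum.inr i ∈ ((⊤ : (addUniv G d).Subgraph).deleteVerts W).verts := by simpa using hi
  have key : ∀ c : K.ConnectedComponent, c = K.connectedComponentMk ⟨_, hz⟩ := by
    intro c
    induction c using SimpleGraph.ConnectedComponent.ind with
    | h v =>
      by_cases hv : v = ⟨_, hz⟩
      · rw [hv]
      · refine SimpleGraph.ConnectedComponent.sound (SimpleGraph.Adj.reachable ?_)
        have hvW : v.1 ∉ W := by simpa using v.2
        have hne : v.1 ≠ Sum.inr i := fun h => hv (Subtype.ext h)
        simp only [hK, SimpleGraph.Subgraph.coe_adj, SimpleGraph.Subgraph.deleteVerts_adj]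
        refine ⟨trivial, hvW, trivial, hi, ?_⟩
        rw [SimpleGraph.Subgraph.top_adj]
        exact ⟨hne, fun a b _ hb => by cases hb⟩
  refine (Set.ncard_le_one_iff (Set.toFinite _)).2 ?_
  intro a b _ _
  rw [key a, key b]

/-- A perfect matching of `addUniv G d` gives a matching of `G`. -/
lemma matching_of_addUniv {V : Type*} [Fintype V] [DecidableEq V] (G : SimpleGraph V) (d : ℕ)
    (M : (addUniv G d).Subgraph) (hM : M.IsPerfectMatching) :
    ∃ N : Finset (Sym2 V), IsMatching G N ∧ Fintype.card V ≤ 2 * N.card + d := by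
  classical
  set N : Finset (Sym2 V) := Finset.univ.filter (fun e => e.map Sum.inl ∈ M.edgeSet) with hN
  have hmem : ∀ u v, s(u, v) ∈ N ↔ M.Adj (Sum.inl u) (Sum.inl v) := by
    intro u v
    simp [hN]
  refine ⟨N, ⟨?_, ?_⟩, ?_⟩
  · intro e he
    induction e with
    | h u v =>
      rw [hmem] at he
      exact (addUniv_inl G d u v).1 he.adj_sub
  · intro e he f hf hne v hve hvf
    obtain ⟨a, rfl⟩ := hve
    obtain ⟨b, rfl⟩ := hvf
    rw [hmem] at he hf
    exact hne (by rw [Sum.inl_injective (hM.1.eq_of_adj_left he hf)])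
  · have hp := SimpleGraph.Subgraph.isPerfectMatching_iff.1 hM
    choose p hp1 hp2 using hp
    set B : Finset V := Finset.univ.filter (fun v => ∃ i, p (Sum.inl v) = Sum.inr i) with hB
    have hBc : B.card ≤ d := by
      have : (B.image (fun v => p (Sum.inl v))).card ≤
          ((Finset.univ : Finset (Fin d)).image (Sum.inr : Fin d → V ⊕ Fin d)).card := by
        refine Finset.card_le_card ?_
        intro z hz
        obtain ⟨v, hv, rfl⟩ := Finset.mem_image.1 hz
        obtain ⟨i, hi⟩ := (Finset.mem_filter.1 hv).2
        exact Finset.mem_image.2 ⟨i, Finset.mem_univ _, hi.symm⟩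
      rw [Finset.card_image_of_injective] at this
      · refine this.trans (Finset.card_image_le.trans (by simp))
      · intro u v huv
        have h1 := hp1 (Sum.inl u)
        have h2 := hp1 (Sum.inl v)
        simp only at huv
        rw [huv] at h1
        exact Sum.inl_injective (hM.1.eq_of_adj_right h1 h2)
    have hcov : (Finset.univ : Finset V) ⊆ N.biUnion (fun e => e.toFinset) ∪ B := by
      intro v _
      rw [Finset.mem_union]
      rcases h : p (Sum.inl v) with w | i
      · left
        refine Finset.mem_biUnion.2 ⟨s(v, w), ?_, by simp⟩
        rw [hmem, ← h]
        exact hp1 _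
      · right
        exact Finset.mem_filter.2 ⟨Finset.mem_univ _, i, h⟩
    have h1 := Finset.card_le_card hcov
    have h2 := Finset.card_union_le (N.biUnion (fun e => e.toFinset)) B
    have h3 := Finset.card_biUnion_le_card_mul N (fun e => e.toFinset) 2 (fun e _ => by
      rw [Sym2.card_toFinset]; split_ifs <;> norm_num)
    rw [Finset.card_univ] at h1
    omega

/-- Tutte–Berge formula (the hard direction). -/
lemma tutte_berge {V : Type*} [Fintype V] [DecidableEq V] (G : SimpleGraph V) :
    ∃ (N : Finset (Sym2 V)) (U : Set V), IsMatching G N ∧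
      Fintype.card V + U.ncard ≤ 2 * N.card + oddc G U := by
  classical
  obtain ⟨U, hU⟩ := Finite.exists_max (fun U : Set V => (oddc G U : ℤ) - U.ncard)
  have h0 := hU ∅
  simp only [Set.ncard_empty] at h0
  obtain ⟨d, hd⟩ : ∃ d : ℕ, oddc G U = U.ncard + d :=
    ⟨oddc G U - U.ncard, by omega⟩
  have hpar := oddc_parity G U
  have htutte : ∃ M : (addUniv G d).Subgraph, M.IsPerfectMatching := by
    rw [SimpleGraph.tutte]
    intro W hW
    change W.ncard < oddc (addUniv G d) W at hW
    have hparW := oddc_parity (addUniv G d) W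
    have hcard : Nat.card (V ⊕ Fin d) = Nat.card V + d := by simp
    by_cases hall : ∀ i, Sum.inr i ∈ W
    · rw [oddc_addUniv_all G d W hall] at hW
      have h1 := hU (Sum.inl ⁻¹' W)
      have h2 : W.ncard = (Sum.inl ⁻¹' W : Set V).ncard + d := by
        have hWe : W = Sum.inl '' (Sum.inl ⁻¹' W : Set V) ∪ Set.range Sum.inr := by
          ext z
          rcases z with v | i <;> simp [hall]
        conv_lhs => rw [hWe]
        rw [Set.ncard_union_eq, Set.ncard_image_of_injective _ Sum.inl_injective]
        · congr 1
          rw [← Set.image_univ, Set.ncard_image_of_injective _ Sum.inr_injective]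
          simp
        · rw [Set.disjoint_left]
          rintro _ ⟨a, _, rfl⟩ ⟨b, hb⟩
          cases hb
      omega
    · push Not at hall
      obtain ⟨i, hi⟩ := hall
      have := oddc_addUniv_not G d W i hi
      omega
  obtain ⟨M, hM⟩ := htutte
  obtain ⟨N, hN, hc⟩ := matching_of_addUniv G d M hM
  exact ⟨N, U, hN, by omega⟩

/-- If `x` is a fractional matching of `G` satisfying the blossom inequality
`Σ_{e∈G[S]} x_e ≤ ⌊|S|/2⌋` for all vertex sets `S` with `|S| < 1/ε`, then `G` has an
(integral) matching of size at least `(1−ε)·Σ_e x_e`, i.e. `μ(G) ≥ (1−ε)·Σ_e x_e`. -/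
theorem stmt4 {V : Type*} [Fintype V] [DecidableEq V]
    (ε : ℝ) (hε : 0 < ε) (G : SimpleGraph V) [DecidableRel G.Adj]
    (x : Sym2 V → ℝ) (hx : IsFracMatching G x)
    (hblossom : ∀ S : Finset V, (S.card : ℝ) < 1 / ε →
      ∑ e ∈ G.edgeFinset.filter (fun e => ∀ v ∈ e, v ∈ S), x e ≤ ((S.card / 2 : ℕ) : ℝ)) :
    ∃ N : Finset (Sym2 V), IsMatching G N ∧
      (N.card : ℝ) ≥ (1 - ε) * ∑ e ∈ G.edgeFinset, x e := by
  rcases le_or_gt 1 ε with h1 | h1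
  · refine ⟨∅, ⟨by simp, by simp⟩, ?_⟩
    have : 0 ≤ ∑ e ∈ G.edgeFinset, x e := Finset.sum_nonneg fun e he => (hx.1 e he).1
    simp only [Finset.card_empty, Nat.cast_zero, ge_iff_le]
    nlinarith
  classical
  obtain ⟨N, U, hN, hcard⟩ := tutte_berge G
  refine ⟨N, hN, ?_⟩
  set K := ((⊤ : G.Subgraph).deleteVerts U).coe with hK
  have : Fintype K.ConnectedComponent := Fintype.ofFinite _
  set S : K.ConnectedComponent → Finset V := fun c => (Subtype.val '' c.supp).toFinset with hS
  have hmemS : ∀ (v : V) (hv : v ∈ ((⊤ : G.Subgraph).deleteVerts U).verts),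
      v ∈ S (K.connectedComponentMk ⟨v, hv⟩) := by
    intro v hv
    simp only [hS, Set.mem_toFinset]
    exact ⟨⟨v, hv⟩, rfl, rfl⟩
  have hcov := frac_cover ε hε h1 G x hx hblossom U.toFinset S (by
    intro e he
    induction e with
    | h a b =>
      have hab : G.Adj a b := by simpa using he
      by_cases ha : a ∈ U
      · exact Or.inl ⟨a, by simpa using ha, by simp⟩
      by_cases hb : b ∈ U
      · exact Or.inl ⟨b, by simpa using hb, by simp⟩
      right
      have ha' : a ∈ ((⊤ : G.Subgraph).deleteVerts U).verts := by simpa using ha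
      have hb' : b ∈ ((⊤ : G.Subgraph).deleteVerts U).verts := by simpa using hb
      refine ⟨K.connectedComponentMk ⟨a, ha'⟩, ?_⟩
      intro v hv
      rcases Sym2.mem_iff.1 hv with rfl | rfl
      · exact hmemS _ ha'
      · have : K.connectedComponentMk ⟨a, ha'⟩ = K.connectedComponentMk ⟨v, hb'⟩ := by
          refine SimpleGraph.ConnectedComponent.sound (SimpleGraph.Adj.reachable ?_)
          simp [hK, ha, hb, hab]
        rw [this]
        exact hmemS _ hb')
  have hScard : ∀ c, (S c).card = c.supp.ncard := by
    intro c
    rw [← Set.ncard_eq_toFinset_card', Set.ncard_image_of_injective _ Subtype.val_injective]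
  have hV : U.ncard + ∑ c, (S c).card = Fintype.card V := by
    have hun : (Finset.univ : Finset V) = U.toFinset ∪ Finset.univ.biUnion S := by
      ext v
      simp only [Finset.mem_univ, Finset.mem_union, Finset.mem_biUnion, true_and, true_iff]
      by_cases hv : v ∈ U
      · left; simpa using hv
      · right; exact ⟨_, hmemS v (by simpa using hv)⟩
    rw [← Finset.card_univ, hun, Finset.card_union_of_disjoint, Finset.card_biUnion,
      Set.ncard_eq_toFinset_card']
    · intro c _ c' _ hcc
      rw [Function.onFun, Finset.disjoint_left]
      intro v hv hv'
      simp only [hS, Set.mem_toFinset] at hv hv'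
      obtain ⟨a, ha, rfl⟩ := hv
      obtain ⟨b, hb, hab⟩ := hv'
      have := Subtype.ext hab
      subst this
      exact hcc (ha.symm.trans hb)
    · rw [Finset.disjoint_left]
      intro v hv hv'
      obtain ⟨c, _, hc⟩ := Finset.mem_biUnion.1 hv'
      simp only [hS, Set.mem_toFinset] at hc hv
      obtain ⟨a, _, rfl⟩ := hc
      have := a.2
      simp at this
      exact this hv
  have hodd : oddc G U = ∑ c, (S c).card % 2 := by
    change K.oddComponents.ncard = _
    rw [Set.ncard_eq_toFinset_card']
    have : K.oddComponents.toFinset = Finset.univ.filter (fun c => Odd (S c).card) := by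
      ext c
      simp [hScard]
    rw [this, Finset.card_filter]
    refine Finset.sum_congr rfl fun c _ => ?_
    split_ifs with h
    · exact (Nat.odd_iff.1 h).symm
    · rw [Nat.not_odd_iff] at h
      exact h.symm
  have hsum : ∑ c, (S c).card = 2 * ∑ c, (S c).card / 2 + ∑ c, (S c).card % 2 := by
    rw [Finset.mul_sum, ← Finset.sum_add_distrib]
    exact Finset.sum_congr rfl fun c _ => by omega
  have hfin : U.ncard + ∑ c, (S c).card / 2 ≤ N.card := by omega
  have hfin' : (U.ncard : ℝ) + ∑ c, (((S c).card / 2 : ℕ) : ℝ) ≤ N.card := by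
    exact_mod_cast hfin
  rw [← Set.ncard_eq_toFinset_card'] at hcov
  linarith
end

section
/- Let 0 < ε < 1, let b = 1 + √2, let G be a graph, and let x be a fractional matching on G. Suppose M₁ and M₂ are matchings in G such that x_e ≤ 1 − 1/b for every edge e ∈ M₁, x_e ≤ 1/b for every edge e ∈ M₂ \ M₁, and x_e ≤ ε³ for every edge e ∉ M₁ ∪ M₂. Then for every vertex set S ⊆ V(G) with |S| = 2s+1 ≤ 1/ε, it holds that Σ_{e∈G[S]} x_e ≤ s + ε. -/
theorem matching_card_aux {V : Type*} [DecidableEq V] (G : SimpleGraph V)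
    (N : Finset (Sym2 V)) (hN : IsMatching G N) (S : Finset V) (s : ℕ)
    (hodd : S.card = 2 * s + 1) (T : Finset (Sym2 V)) (hT : T ⊆ N)
    (hTS : ∀ e ∈ T, ∀ v ∈ e, v ∈ S) : T.card ≤ s := by
  have h1 : (T.biUnion (fun e => e.toFinset)).card = ∑ e ∈ T, e.toFinset.card := by
    apply Finset.card_biUnion
    intro e he f hf hef
    rw [Function.onFun, Finset.disjoint_left]
    intro v hv hv'
    rw [Sym2.mem_toFinset] at hv hv'
    exact hN.2 e (hT he) f (hT hf) hef v hv hv'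
  have h2 : ∑ e ∈ T, e.toFinset.card = ∑ e ∈ T, 2 := by
    apply Finset.sum_congr rfl
    intro e he
    exact Sym2.card_toFinset_of_not_isDiag e
      (G.not_isDiag_of_mem_edgeSet (hN.1 e (hT he)))
  have h3 : (T.biUnion (fun e => e.toFinset)).card ≤ S.card := by
    apply Finset.card_le_card
    intro v hv
    rw [Finset.mem_biUnion] at hv
    obtain ⟨e, he, hv⟩ := hv
    exact hTS e he v (Sym2.mem_toFinset.1 hv)
  simp only [Finset.sum_const, smul_eq_mul] at h2
  omega

/-- Let `0 < ε < 1`, `b = 1 + √2`, and let `x` be a fractional matching of `G` with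
`x_e ≤ 1 − 1/b` on a matching `M₁`, `x_e ≤ 1/b` on `M₂ \ M₁` for a matching `M₂`, and
`x_e ≤ ε³` on all other edges. Then for every vertex set `S` with `|S| = 2s+1 ≤ 1/ε`,
`Σ_{e∈G[S]} x_e ≤ s + ε`. -/
theorem stmt5 {V : Type*} [Fintype V] [DecidableEq V]
    (ε b : ℝ) (hε0 : 0 < ε) (hε1 : ε < 1) (hb : b = 1 + Real.sqrt 2)
    (G : SimpleGraph V) [DecidableRel G.Adj]
    (x : Sym2 V → ℝ) (hx : IsFracMatching G x)
    (M₁ M₂ : Finset (Sym2 V)) (hM₁ : IsMatching G M₁) (hM₂ : IsMatching G M₂)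
    (hx1 : ∀ e ∈ M₁, x e ≤ 1 - 1 / b)
    (hx2 : ∀ e ∈ M₂, e ∉ M₁ → x e ≤ 1 / b)
    (hx3 : ∀ e ∈ G.edgeFinset, e ∉ M₁ ∪ M₂ → x e ≤ ε ^ 3)
    (S : Finset V) (s : ℕ) (hodd : S.card = 2 * s + 1) (hsize : (S.card : ℝ) ≤ 1 / ε) :
    ∑ e ∈ G.edgeFinset.filter (fun e => ∀ v ∈ e, v ∈ S), x e ≤ (s : ℝ) + ε := by
  set F := G.edgeFinset.filter (fun e => ∀ v ∈ e, v ∈ S) with hF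
  have hFS : ∀ e ∈ F, ∀ v ∈ e, v ∈ S := fun e he => (Finset.mem_filter.1 he).2
  have hFG : ∀ e ∈ F, e ∈ G.edgeFinset := fun e he => (Finset.mem_filter.1 he).1
  have hb1 : 1 < b := by
    rw [hb]
    have : 0 < Real.sqrt 2 := by positivity
    linarith
  have hβ0 : 0 ≤ 1 / b := by positivity
  have hα0 : 0 ≤ 1 - 1 / b := by
    have : 1 / b ≤ 1 := by rw [div_le_one (by linarith)]; linarith
    linarith
  have e1 := Finset.sum_filter_add_sum_filter_not F (fun e => e ∈ M₁) x
  have e2 := Finset.sum_filter_add_sum_filter_not (F.filter (fun e => e ∉ M₁)) (fun e => e ∈ M₂) x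
  have c1 : ((F.filter (fun e => e ∈ M₁)).card : ℝ) ≤ s := by
    exact_mod_cast matching_card_aux G M₁ hM₁ S s hodd _
      (fun e he => (Finset.mem_filter.1 he).2) (fun e he => hFS e (Finset.mem_filter.1 he).1)
  have c2 : (((F.filter (fun e => e ∉ M₁)).filter (fun e => e ∈ M₂)).card : ℝ) ≤ s := by
    exact_mod_cast matching_card_aux G M₂ hM₂ S s hodd _
      (fun e he => (Finset.mem_filter.1 he).2)
      (fun e he => hFS e (Finset.mem_filter.1 (Finset.mem_filter.1 he).1).1)
  have c3 : ((((F.filter (fun e => e ∉ M₁)).filter (fun e => e ∉ M₂)).card : ℕ) : ℝ)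
      ≤ (S.card : ℝ) * S.card := by
    have : ((F.filter (fun e => e ∉ M₁)).filter (fun e => e ∉ M₂)).card
        ≤ ((S ×ˢ S).image (fun p : V × V => s(p.1, p.2))).card := by
      apply Finset.card_le_card
      intro e he
      have := hFS e (Finset.mem_filter.1 (Finset.mem_filter.1 he).1).1
      induction e using Sym2.ind with
      | _ u v =>
        rw [Finset.mem_image]
        exact ⟨(u, v), Finset.mem_product.2 ⟨this u (by simp), this v (by simp)⟩, rfl⟩
    have h := this.trans Finset.card_image_le
    rw [Finset.card_product] at h
    exact_mod_cast h
  have b1 : ∑ e ∈ F.filter (fun e => e ∈ M₁), x e ≤ s * (1 - 1 / b) := by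
    refine (Finset.sum_le_card_nsmul _ _ (1 - 1 / b) ?_).trans ?_
    · intro e he
      exact hx1 e (Finset.mem_filter.1 he).2
    · rw [nsmul_eq_mul]
      exact mul_le_mul_of_nonneg_right c1 hα0
  have b2 : ∑ e ∈ (F.filter (fun e => e ∉ M₁)).filter (fun e => e ∈ M₂), x e ≤ s * (1 / b) := by
    refine (Finset.sum_le_card_nsmul _ _ (1 / b) ?_).trans ?_
    · intro e he
      simp only [Finset.mem_filter] at he
      exact hx2 e he.2 he.1.2
    · rw [nsmul_eq_mul]
      exact mul_le_mul_of_nonneg_right c2 hβ0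
  have b3 : ∑ e ∈ (F.filter (fun e => e ∉ M₁)).filter (fun e => e ∉ M₂), x e ≤ ε := by
    refine (Finset.sum_le_card_nsmul _ _ (ε ^ 3) ?_).trans ?_
    · intro e he
      have h1 := Finset.mem_filter.1 he
      have h2 := Finset.mem_filter.1 h1.1
      refine hx3 e (hFG e h2.1) ?_
      rw [Finset.mem_union]
      exact fun h => h.elim h2.2 h1.2
    · rw [nsmul_eq_mul]
      have hn : (S.card : ℝ) * ε ≤ 1 := (le_div_iff₀ hε0).1 hsize
      have hn0 : 0 ≤ (S.card : ℝ) * ε := by positivity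
      calc _ ≤ ((S.card : ℝ) * S.card) * ε ^ 3 := by gcongr
        _ = ((S.card : ℝ) * ε) * ((S.card : ℝ) * ε) * ε := by ring
        _ ≤ 1 * ε := by
          gcongr
          exact mul_le_one₀ hn hn0 hn
        _ = ε := one_mul _
  have e3 : (s : ℝ) * (1 - 1 / b) + s * (1 / b) = s := by ring
  linarith
end

section
/- Let 0 < ε < 1, let b = 1 + √2, let G be a graph, and let x be a fractional matching on G. Suppose M₁ and M₂ are matchings in G such that x_e ≤ 1 − 1/b for every edge e ∈ M₁, x_e ≤ 1/b for every edge e ∈ M₂ \ M₁, and x_e ≤ ε³ for every edge e ∉ M₁ ∪ M₂. Then G contains an (integral) matching of size at least (1−ε)² · Σ_{e∈E(G)} x_e. -/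
/-- Double counting. -/
lemma two_mul_sum_le {V : Type*} [DecidableEq V] (F : Finset (Sym2 V)) (B : Finset V)
    (hd : ∀ e ∈ F, ¬ e.IsDiag) (hB : ∀ e ∈ F, ∀ v ∈ e, v ∈ B) (w : Sym2 V → ℝ)
    (hw : ∀ v ∈ B, ∑ e ∈ F.filter (fun e => v ∈ e), w e ≤ 1) :
    2 * ∑ e ∈ F, w e ≤ B.card := by
  have h1 : ∑ v ∈ B, ∑ e ∈ F.filter (fun e => v ∈ e), w e = 2 * ∑ e ∈ F, w e := by
    simp_rw [Finset.sum_filter]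
    rw [Finset.sum_comm, Finset.mul_sum]
    refine Finset.sum_congr rfl fun e he => ?_
    rw [← Finset.sum_filter, Finset.sum_const]
    have : B.filter (fun v => v ∈ e) = e.toFinset := by
      ext v
      simp only [Finset.mem_filter, Sym2.mem_toFinset]
      exact ⟨fun h => h.2, fun h => ⟨hB e he v h, h⟩⟩
    rw [this, Sym2.card_toFinset_of_not_isDiag e (hd e he)]
    simp
  rw [← h1]
  calc _ ≤ ∑ v ∈ B, (1 : ℝ) := Finset.sum_le_sum hw
    _ = _ := by simp

lemma matching_card_le {V : Type*} [DecidableEq V] (G : SimpleGraph V) (M F : Finset (Sym2 V))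
    (hM : IsMatching G M) (hF : F ⊆ M) (B : Finset V)
    (hB : ∀ e ∈ F, ∀ v ∈ e, v ∈ B) : F.card ≤ B.card / 2 := by
  have := two_mul_sum_le F B (fun e he => G.not_isDiag_of_mem_edgeSet (hM.1 e (hF he))) hB
    (fun _ => 1) (by
      intro v _
      rw [Finset.sum_const, nsmul_eq_mul, mul_one]
      have : (F.filter (fun e => v ∈ e)).card ≤ 1 := by
        rw [Finset.card_le_one]
        intro a ha c hc
        simp only [Finset.mem_filter] at ha hc
        by_contra hne
        exact hM.2 a (hF ha.1) c (hF hc.1) hne v ha.2 hc.2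
      exact_mod_cast this)
  rw [Finset.sum_const, nsmul_eq_mul, mul_one] at this
  have : 2 * F.card ≤ B.card := by exact_mod_cast this
  omega

lemma edges_card_le {V : Type*} [DecidableEq V] (F : Finset (Sym2 V)) (B : Finset V)
    (hd : ∀ e ∈ F, ¬ e.IsDiag) (hB : ∀ e ∈ F, ∀ v ∈ e, v ∈ B) :
    F.card ≤ B.card.choose 2 := by
  rw [← Sym2.card_image_offDiag]
  refine Finset.card_le_card fun e he => ?_
  have h1 := hd e he
  have h2 := hB e he
  induction e with | _ a c =>
  simp only [Sym2.isDiag_iff_proj_eq] at h1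
  exact Finset.mem_image.2 ⟨(a, c), by simp [Finset.mem_offDiag, h1, h2], rfl⟩

lemma odd_set_bound {V : Type*} [Fintype V] [DecidableEq V]
    (ε c : ℝ) (hε0 : 0 < ε) (hε1 : ε < 1) (hc0 : 0 ≤ c) (hc1 : c ≤ 1)
    (G : SimpleGraph V) [DecidableRel G.Adj]
    (x : Sym2 V → ℝ) (hx : IsFracMatching G x)
    (M₁ M₂ : Finset (Sym2 V)) (hM₁ : IsMatching G M₁) (hM₂ : IsMatching G M₂)
    (hx1 : ∀ e ∈ M₁, x e ≤ 1 - c)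
    (hx2 : ∀ e ∈ M₂, e ∉ M₁ → x e ≤ c)
    (hx3 : ∀ e ∈ G.edgeFinset, e ∉ M₁ ∪ M₂ → x e ≤ ε ^ 3) (B : Finset V) :
    (1 - ε) ^ 2 * ∑ e ∈ G.edgeFinset.filter (fun e => ∀ v ∈ e, v ∈ B), x e
      ≤ ((B.card / 2 : ℕ) : ℝ) := by
  set F := G.edgeFinset.filter (fun e => ∀ v ∈ e, v ∈ B) with hF
  have hFE : F ⊆ G.edgeFinset := Finset.filter_subset _ _
  have hFB : ∀ e ∈ F, ∀ v ∈ e, v ∈ B := fun e he => (Finset.mem_filter.1 he).2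
  have hFd : ∀ e ∈ F, ¬ e.IsDiag := fun e he =>
    G.not_isDiag_of_mem_edgeSet (SimpleGraph.mem_edgeFinset.1 (hFE he))
  set S := ∑ e ∈ F, x e with hS
  have hS0 : 0 ≤ S := Finset.sum_nonneg fun e he => (hx.1 e (hFE he)).1
  have h2S : 2 * S ≤ B.card := two_mul_sum_le F B hFd hFB x (by
    intro v _
    refine le_trans (Finset.sum_le_sum_of_subset_of_nonneg
      (Finset.filter_subset_filter _ hFE) ?_) (hx.2 v)
    intro e he _
    exact (hx.1 e (Finset.mem_filter.1 he).1).1)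
  have hsq : (1 - ε) ^ 2 ≤ 1 - ε := by nlinarith
  rcases Nat.even_or_odd' B.card with ⟨k, hk | hk⟩
  · have : B.card / 2 = k := by omega
    rw [this]
    rw [hk] at h2S
    push_cast at h2S
    nlinarith
  have hk2 : B.card / 2 = k := by omega
  rw [hk2]
  have hk0 : (0 : ℝ) ≤ k := Nat.cast_nonneg k
  rw [hk] at h2S
  push_cast at h2S
  by_cases hbig : 1 ≤ ε * (2 * k + 1)
  · have : (1 - ε) * S ≤ k := by nlinarith
    nlinarith
  push Not at hbig
  -- small odd set
  have hsplit : S ≤ (k : ℝ) * (1 - c) + k * c + (k * (2 * k + 1)) * ε ^ 3 := by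
    rw [hS, ← Finset.sum_filter_add_sum_filter_not F (fun e => e ∈ M₁),
      ← Finset.sum_filter_add_sum_filter_not (F.filter (fun e => e ∉ M₁)) (fun e => e ∈ M₂),
      ← add_assoc]
    have hb1 : ∀ (F' : Finset (Sym2 V)) (t : ℝ) (n : ℕ), 0 ≤ t → F'.card ≤ n →
        (∀ e ∈ F', x e ≤ t) → ∑ e ∈ F', x e ≤ n * t := by
      intro F' t n ht hn h
      refine (Finset.sum_le_card_nsmul _ _ _ h).trans ?_
      rw [nsmul_eq_mul]
      exact mul_le_mul_of_nonneg_right (by exact_mod_cast hn) ht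
    refine add_le_add (add_le_add ?_ ?_) ?_
    · refine hb1 _ _ _ (by linarith) ?_ ?_
      · rw [← hk2]
        exact matching_card_le G M₁ _ hM₁ (fun e he => (Finset.mem_filter.1 he).2) B
          (fun e he => hFB e (Finset.mem_filter.1 he).1)
      · exact fun e he => hx1 e (Finset.mem_filter.1 he).2
    · refine hb1 _ _ _ hc0 ?_ ?_
      · rw [← hk2]
        exact matching_card_le G M₂ _ hM₂ (fun e he => (Finset.mem_filter.1 he).2) B
          (fun e he => hFB e (Finset.mem_filter.1 (Finset.mem_filter.1 he).1).1)
      · intro e he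
        simp only [Finset.mem_filter] at he
        exact hx2 e he.2 he.1.2
    · have hn : (F.card) ≤ k * (2 * k + 1) := by
        refine (edges_card_le F B hFd hFB).trans ?_
        rw [hk, Nat.choose_two_right]
        have : (2 * k + 1) * (2 * k + 1 - 1) = 2 * (k * (2 * k + 1)) := by
          rw [Nat.add_sub_cancel]; ring
        rw [this]; omega
      have := hb1 ((F.filter (fun e => e ∉ M₁)).filter (fun e => e ∉ M₂)) (ε ^ 3)
        (k * (2 * k + 1)) (by positivity)
        ((Finset.card_le_card ((Finset.filter_subset _ _).trans (Finset.filter_subset _ _))).trans hn)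
        (by
          intro e he
          simp only [Finset.mem_filter] at he
          exact hx3 e (hFE he.1.1) (by simp [he.1.2, he.2]))
      push_cast at this
      exact this
  have h3 : S ≤ k * (1 + ε ^ 2) := by
    have : (k : ℝ) * ε ^ 2 * (ε * (2 * k + 1)) ≤ k * ε ^ 2 * 1 :=
      mul_le_mul_of_nonneg_left hbig.le (by positivity)
    nlinarith
  have h4 : (1 - ε) ^ 2 * (1 + ε ^ 2) ≤ 1 := by
    have : (1 - ε) * (1 + ε ^ 2) ≤ 1 := by nlinarith [mul_pos hε0 hε0, pow_pos hε0 3]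
    nlinarith [sq_nonneg ε]
  calc (1 - ε) ^ 2 * S ≤ (1 - ε) ^ 2 * (k * (1 + ε ^ 2)) :=
        mul_le_mul_of_nonneg_left h3 (sq_nonneg _)
    _ = k * ((1 - ε) ^ 2 * (1 + ε ^ 2)) := by ring
    _ ≤ k * 1 := mul_le_mul_of_nonneg_left h4 hk0
    _ = k := mul_one _

/-- `G` joined with `d` universal vertices. -/
def joinGraph {V : Type*} (G : SimpleGraph V) (d : ℕ) : SimpleGraph (V ⊕ Fin d) where
  Adj a c := a ≠ c ∧ ∀ u v, a = Sum.inl u → c = Sum.inl v → G.Adj u v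
  symm := ⟨fun a c h => ⟨h.1.symm, fun u v hu hv => (h.2 v u hv hu).symm⟩⟩
  loopless := ⟨fun a h => h.1 rfl⟩

lemma matching_of_perfect {V : Type*} [Fintype V] [DecidableEq V] (G : SimpleGraph V)
    [DecidableRel G.Adj] (d : ℕ) (M : (joinGraph G d).Subgraph) (hM : M.IsPerfectMatching) :
    ∃ N : Finset (Sym2 V), IsMatching G N ∧ Fintype.card V ≤ 2 * N.card + d := by
  classical
  have huniq : ∀ {a c c'}, M.Adj a c → M.Adj a c' → c = c' := by
    intro a c c' h h'
    exact (hM.1 h.fst_mem).unique h h'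
  have hadj : ∀ {u v : V}, M.Adj (Sum.inl u) (Sum.inl v) → G.Adj u v := by
    intro u v h
    exact h.adj_sub.2 u v rfl rfl
  let N : Finset (Sym2 V) := G.edgeFinset.filter (fun e => e.map Sum.inl ∈ M.edgeSet)
  have hmem : ∀ {u v : V}, s(u, v) ∈ N ↔ M.Adj (Sum.inl u) (Sum.inl v) := by
    intro u v
    simp only [N, Finset.mem_filter, SimpleGraph.mem_edgeFinset, SimpleGraph.mem_edgeSet,
      Sym2.map_mk, SimpleGraph.Subgraph.mem_edgeSet]
    exact ⟨fun h => h.2, fun h => ⟨hadj h, h⟩⟩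
  refine ⟨N, ⟨fun e he => SimpleGraph.mem_edgeFinset.1 (Finset.mem_filter.1 he).1, ?_⟩, ?_⟩
  · intro e he f hf hne v hve hvf
    obtain ⟨a, rfl⟩ := Sym2.mem_iff_exists.1 hve
    obtain ⟨c, rfl⟩ := Sym2.mem_iff_exists.1 hvf
    have := huniq (hmem.1 he) (hmem.1 hf)
    rw [Sum.inl.injEq] at this
    exact hne (by rw [this])
  · let T : Finset V := Finset.univ.filter (fun v => ∃ w, M.Adj (Sum.inl v) (Sum.inr w))
    have hT : T.card ≤ d := by
      have : ∀ v : T, ∃ w, M.Adj (Sum.inl v.1) (Sum.inr w) := fun v =>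
        (Finset.mem_filter.1 v.2).2
      choose p hp using this
      have hinj : Function.Injective p := by
        intro v v' h
        have h1 := (hp v).symm
        have h2 := (hp v').symm
        rw [h] at h1
        exact Subtype.ext (Sum.inl_injective (huniq h1 h2))
      simpa using Fintype.card_le_of_injective p hinj
    have hcov : (Finset.univ : Finset V) ⊆ N.biUnion Sym2.toFinset ∪ T := by
      intro v _
      obtain ⟨w, hw, -⟩ := hM.1 (hM.2 (Sum.inl v))
      rw [Finset.mem_union]
      rcases w with w | w
      · left
        exact Finset.mem_biUnion.2 ⟨s(v, w), hmem.2 hw, by simp⟩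
      · right
        exact Finset.mem_filter.2 ⟨Finset.mem_univ _, w, hw⟩
    have h1 := Finset.card_le_card hcov
    have h2 := Finset.card_union_le (N.biUnion Sym2.toFinset) T
    have h3 : (N.biUnion Sym2.toFinset).card ≤ N.card * 2 :=
      Finset.card_biUnion_le_card_mul _ _ _ (fun e he => by
        rw [Sym2.card_toFinset_of_not_isDiag]
        exact G.not_isDiag_of_mem_edgeSet
          (SimpleGraph.mem_edgeFinset.1 (Finset.mem_filter.1 he).1))
    rw [Finset.card_univ] at h1
    omega

lemma component_count {W : Type*} [Fintype W] (H : SimpleGraph W)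
    [Fintype H.ConnectedComponent] :
    Fintype.card W = H.oddComponents.ncard + 2 * ∑ C : H.ConnectedComponent, C.supp.ncard / 2 := by
  classical
  have h1 : Fintype.card W = ∑ C : H.ConnectedComponent, C.supp.ncard := by
    rw [← Finset.card_univ, Finset.card_eq_sum_card_fiberwise
      (f := H.connectedComponentMk) (t := Finset.univ) (by simp)]
    refine Finset.sum_congr rfl fun C _ => ?_
    rw [← Set.ncard_coe_finset]
    congr 1
    ext v
    simp [SimpleGraph.ConnectedComponent.mem_supp_iff]
  have h2 : H.oddComponents.ncard = ∑ C : H.ConnectedComponent, C.supp.ncard % 2 := by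
    have : H.oddComponents = ↑(Finset.univ.filter
        (fun C : H.ConnectedComponent => Odd C.supp.ncard)) := by
      ext C; simp [SimpleGraph.oddComponents]
    rw [this, Set.ncard_coe_finset, Finset.card_filter]
    refine Finset.sum_congr rfl fun C _ => ?_
    split_ifs with h
    · exact (Nat.odd_iff.1 h).symm
    · exact (Nat.even_iff.1 (Nat.not_odd_iff_even.1 h)).symm
  rw [h1, h2, Finset.mul_sum, ← Finset.sum_add_distrib]
  exact Finset.sum_congr rfl fun C _ => by omega

/-- Let `0 < ε < 1`, `b = 1 + √2`, and let `x` be a fractional matching of `G` with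
`x_e ≤ 1 − 1/b` on a matching `M₁`, `x_e ≤ 1/b` on `M₂ \ M₁` for a matching `M₂`, and
`x_e ≤ ε³` on all other edges. Then `G` contains an integral matching of size at least
`(1−ε)²·Σ_e x_e`. -/
theorem stmt6 {V : Type*} [Fintype V] [DecidableEq V]
    (ε b : ℝ) (hε0 : 0 < ε) (hε1 : ε < 1) (hb : b = 1 + Real.sqrt 2)
    (G : SimpleGraph V) [DecidableRel G.Adj]
    (x : Sym2 V → ℝ) (hx : IsFracMatching G x)
    (M₁ M₂ : Finset (Sym2 V)) (hM₁ : IsMatching G M₁) (hM₂ : IsMatching G M₂)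
    (hx1 : ∀ e ∈ M₁, x e ≤ 1 - 1 / b)
    (hx2 : ∀ e ∈ M₂, e ∉ M₁ → x e ≤ 1 / b)
    (hx3 : ∀ e ∈ G.edgeFinset, e ∉ M₁ ∪ M₂ → x e ≤ ε ^ 3) :
    ∃ N : Finset (Sym2 V), IsMatching G N ∧
      (N.card : ℝ) ≥ (1 - ε) ^ 2 * ∑ e ∈ G.edgeFinset, x e := by
  classical
  have hb1 : 1 ≤ b := by rw [hb]; linarith [Real.sqrt_nonneg 2]
  have key := odd_set_bound ε (1 / b) hε0 hε1 (by positivity)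
    (by rw [div_le_one (by linarith)]; exact hb1) G x hx M₁ M₂ hM₁ hM₂ hx1 hx2 hx3
  set X := (1 - ε) ^ 2 * ∑ e ∈ G.edgeFinset, x e with hX
  have hVb : X ≤ ((Fintype.card V / 2 : ℕ) : ℝ) := by
    have := key Finset.univ
    simpa [hX] using this
  set s := ⌈X⌉₊ with hs
  have hsV : s ≤ Fintype.card V / 2 := Nat.ceil_le.2 hVb
  by_cases hs0 : s = 0
  · refine ⟨∅, ⟨by simp, by simp⟩, ?_⟩
    simpa using Nat.ceil_eq_zero.1 hs0
  set d := Fintype.card V - 2 * s with hd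
  by_cases hP : ∃ M : (joinGraph G d).Subgraph, M.IsPerfectMatching
  · obtain ⟨M, hM⟩ := hP
    obtain ⟨N, hN, hc⟩ := matching_of_perfect G d M hM
    refine ⟨N, hN, ?_⟩
    have : s ≤ N.card := by omega
    exact Nat.ceil_le.1 this
  exfalso
  rw [SimpleGraph.tutte] at hP
  push Not at hP
  obtain ⟨u, hu⟩ := hP
  rw [SimpleGraph.IsTutteViolator] at hu
  set H := ((⊤ : (joinGraph G d).Subgraph).deleteVerts u).coe with hH
  have hcc := component_count H
  have hcard : Fintype.card ((⊤ : (joinGraph G d).Subgraph).deleteVerts u).verts + u.ncard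
      = Fintype.card V + d := by
    have h1 := Set.ncard_add_ncard_compl u
    have h2 : ((⊤ : (joinGraph G d).Subgraph).deleteVerts u).verts = uᶜ := by
      ext; simp
    rw [← Nat.card_eq_fintype_card, Nat.card_coe_set_eq, h2]
    rw [Nat.card_eq_fintype_card, Fintype.card_sum, Fintype.card_fin] at h1
    omega
  have hHadj : ∀ (a c : ((⊤ : (joinGraph G d).Subgraph).deleteVerts u).verts),
      (joinGraph G d).Adj a.1 c.1 → H.Adj a c := by
    intro a c h
    have ha := a.2
    have hc := c.2
    simp only [SimpleGraph.Subgraph.deleteVerts_verts, Set.mem_diff] at ha hc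
    simp [hH, h, ha.2, hc.2]
  have hmemv : ∀ a, a ∉ u → a ∈ ((⊤ : (joinGraph G d).Subgraph).deleteVerts u).verts := by
    intro a ha; simp [ha]
  set Fl := ∑ C : H.ConnectedComponent, C.supp.ncard / 2 with hFl
  by_cases hall : ∀ w : Fin d, Sum.inr w ∈ u
  · -- all new vertices are deleted
    let U : Finset V := Finset.univ.filter (fun v => Sum.inl v ∈ u)
    have hU : U.card + d = u.ncard := by
      have : u = ↑(U.disjSum (Finset.univ : Finset (Fin d))) := by
        ext a
        rcases a with a | a
        · simp [U]
        · simp [hall a]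
      rw [this, Set.ncard_coe_finset, Finset.card_disjSum]
      simp
    let B : H.ConnectedComponent → Finset V := fun C =>
      Finset.univ.filter (fun v => ∃ h, H.connectedComponentMk ⟨Sum.inl v, h⟩ = C)
    have hB : ∀ C, (B C).card ≤ C.supp.ncard := by
      intro C
      rw [← Set.ncard_coe_finset]
      refine Set.ncard_le_ncard_of_injOn
        (fun v => if h : Sum.inl v ∉ u then ⟨Sum.inl v, hmemv _ h⟩ else C.exists_rep.choose) ?_ ?_ (Set.toFinite _)
      · intro v hv
        simp only [B, Finset.coe_filter, Finset.mem_univ, true_and, Set.mem_setOf_eq] at hv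
        obtain ⟨h, h'⟩ := hv
        have h2 : Sum.inl v ∉ u := by simpa using h
        simp only [h2, not_false_eq_true, dif_pos]
        exact h'
      · intro v hv v' hv' he
        simp only [B, Finset.coe_filter, Finset.mem_univ, true_and, Set.mem_setOf_eq] at hv hv'
        obtain ⟨h, -⟩ := hv
        obtain ⟨h', -⟩ := hv'
        have h2 : Sum.inl v ∉ u := by simpa using h
        have h2' : Sum.inl v' ∉ u := by simpa using h'
        simpa [h2, h2'] using he
    have hcov : G.edgeFinset ⊆ U.biUnion (fun v => G.edgeFinset.filter (fun e => v ∈ e)) ∪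
        Finset.univ.biUnion (fun C => G.edgeFinset.filter (fun e => ∀ v ∈ e, v ∈ B C)) := by
      intro e he
      induction e with | _ a c =>
      have hac : G.Adj a c := by simpa using he
      rw [Finset.mem_union]
      by_cases ha : Sum.inl a ∈ u
      · left
        exact Finset.mem_biUnion.2 ⟨a, by simp [U, ha], Finset.mem_filter.2 ⟨he, by simp⟩⟩
      by_cases hc : Sum.inl c ∈ u
      · left
        exact Finset.mem_biUnion.2 ⟨c, by simp [U, hc], Finset.mem_filter.2 ⟨he, by simp⟩⟩
      right
      refine Finset.mem_biUnion.2 ⟨H.connectedComponentMk ⟨Sum.inl a, hmemv _ ha⟩,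
        Finset.mem_univ _, Finset.mem_filter.2 ⟨he, ?_⟩⟩
      have hadj : H.Adj ⟨Sum.inl c, hmemv _ hc⟩ ⟨Sum.inl a, hmemv _ ha⟩ := by
        apply hHadj
        refine ⟨?_, ?_⟩
        · simpa using hac.ne'
        · intro p q hp hq
          rw [Sum.inl.injEq] at hp hq
          subst hp hq
          exact hac.symm
      intro v hv
      rw [Sym2.mem_iff] at hv
      rcases hv with rfl | rfl
      · exact Finset.mem_filter.2 ⟨Finset.mem_univ _, hmemv _ ha, rfl⟩
      · exact Finset.mem_filter.2 ⟨Finset.mem_univ _, hmemv _ hc,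
          SimpleGraph.ConnectedComponent.sound hadj.reachable⟩
    have hx0 : ∀ e ∈ G.edgeFinset, 0 ≤ x e := fun e he => (hx.1 e he).1
    have hbi : ∀ {ι : Type _} (I : Finset ι) (f : ι → Finset (Sym2 V)),
        (∀ i ∈ I, f i ⊆ G.edgeFinset) → ∑ e ∈ I.biUnion f, x e ≤ ∑ i ∈ I, ∑ e ∈ f i, x e := by
      intro ι I f
      induction I using Finset.induction_on with
      | empty => simp
      | insert a I ha ih =>
        intro h
        rw [Finset.biUnion_insert, Finset.sum_insert ha]
        have h1 := ih (fun i hi => h i (Finset.mem_insert_of_mem hi))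
        have h2 := Finset.sum_union_inter (s₁ := f a) (s₂ := I.biUnion f) (f := x)
        have h3 : 0 ≤ ∑ e ∈ f a ∩ I.biUnion f, x e := Finset.sum_nonneg fun e he =>
          hx0 e (h a (Finset.mem_insert_self _ _) (Finset.mem_inter.1 he).1)
        linarith
    have hsum : ∑ e ∈ G.edgeFinset, x e ≤ U.card +
        ∑ C : H.ConnectedComponent,
          ∑ e ∈ G.edgeFinset.filter (fun e => ∀ v ∈ e, v ∈ B C), x e := by
      set P := U.biUnion (fun v => G.edgeFinset.filter (fun e => v ∈ e)) with hPdef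
      set Q := Finset.univ.biUnion
        (fun C => G.edgeFinset.filter (fun e => ∀ v ∈ e, v ∈ B C)) with hQdef
      have hPE : P ⊆ G.edgeFinset := Finset.biUnion_subset.2 fun _ _ => Finset.filter_subset _ _
      have hQE : Q ⊆ G.edgeFinset := Finset.biUnion_subset.2 fun _ _ => Finset.filter_subset _ _
      have h1 : ∑ e ∈ G.edgeFinset, x e ≤ ∑ e ∈ P ∪ Q, x e :=
        Finset.sum_le_sum_of_subset_of_nonneg hcov fun e he _ =>
          hx0 e (Finset.union_subset hPE hQE he)
      have h2 := Finset.sum_union_inter (s₁ := P) (s₂ := Q) (f := x)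
      have h3 : 0 ≤ ∑ e ∈ P ∩ Q, x e := Finset.sum_nonneg fun e he =>
        hx0 e (hPE (Finset.mem_inter.1 he).1)
      have h4 : ∑ e ∈ P, x e ≤ U.card := by
        refine (hbi U _ fun _ _ => Finset.filter_subset _ _).trans ?_
        refine (Finset.sum_le_sum fun v _ => hx.2 v).trans ?_
        simp
      have h5 : ∑ e ∈ Q, x e ≤ _ := hbi Finset.univ _ fun _ _ => Finset.filter_subset _ _
      linarith
    have hXle : X ≤ ((U.card + Fl : ℕ) : ℝ) := by
      have hsq1 : (1 - ε) ^ 2 ≤ 1 := by nlinarith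
      have h1 : X ≤ (1 - ε) ^ 2 * (U.card + ∑ C : H.ConnectedComponent,
          ∑ e ∈ G.edgeFinset.filter (fun e => ∀ v ∈ e, v ∈ B C), x e) :=
        mul_le_mul_of_nonneg_left hsum (sq_nonneg _)
      rw [mul_add, Finset.mul_sum] at h1
      have h2 : (1 - ε) ^ 2 * (U.card : ℝ) ≤ U.card :=
        mul_le_of_le_one_left (Nat.cast_nonneg _) hsq1
      have h3 : ∑ C : H.ConnectedComponent, (1 - ε) ^ 2 *
          ∑ e ∈ G.edgeFinset.filter (fun e => ∀ v ∈ e, v ∈ B C), x e ≤ (Fl : ℝ) := by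
        rw [hFl, Nat.cast_sum]
        refine Finset.sum_le_sum fun C _ => (key (B C)).trans ?_
        exact_mod_cast Nat.div_le_div_right (hB C)
      push_cast
      linarith
    have := Nat.ceil_le.2 hXle
    rw [← hs] at this
    omega
  · push Not at hall
    obtain ⟨w, hw⟩ := hall
    have hone : H.oddComponents.ncard ≤ 1 := by
      have hcen : ∀ C : H.ConnectedComponent,
          C = H.connectedComponentMk ⟨Sum.inr w, hmemv _ hw⟩ := by
        intro C
        induction C using SimpleGraph.ConnectedComponent.ind with | _ a =>
        by_cases ha : a.1 = Sum.inr w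
        · congr 1
          exact Subtype.ext ha
        · refine SimpleGraph.ConnectedComponent.sound (SimpleGraph.Adj.reachable ?_)
          apply hHadj
          exact ⟨ha, fun p q _ hq => by simp at hq⟩
      rw [Set.ncard_le_one (Set.toFinite _)]
      intro a _ c _
      rw [hcen a, hcen c]
    omega
end

section
/- Let 0 < ε < 1, let b = 1 + √2, and let k be an integer with k ≥ 1/(bε³). Let G be a graph, let M be a maximal matching of G, let V(M) be the set of vertices covered by M, and let H = G[V(M), V\V(M)] be the bipartite subgraph of G consisting of all edges with exactly one endpoint in V(M). Let B ⊆ E(H) be a set of edges (each edge taken at most once) such that deg_B(u) ≤ k for every u ∈ V(M), deg_B(v) ≤ ⌈kb⌉ for every v ∉ V(M), and every edge (u,v) ∈ E(H) \ B with u ∈ V(M), v ∉ V(M) satisfies deg_B(u) = k or deg_B(v) = ⌈kb⌉. Then the subgraph of G with edge set M ∪ B contains a matching of size at least (1−ε)³ · (2−√2) · μ(G). -/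
/-- `M` is a maximal matching of `G`: a matching to which no edge of `G` can be added. -/
def IsMaximalMatching {V : Type*} [DecidableEq V] (G : SimpleGraph V)
    (M : Finset (Sym2 V)) : Prop :=
  IsMatching G M ∧ ∀ e ∈ G.edgeSet, e ∉ M → ¬ IsMatching G (insert e M)

/-- `v` is covered by the matching `M`, i.e. `v ∈ V(M)`. -/
def Covered {V : Type*} (M : Finset (Sym2 V)) (v : V) : Prop := ∃ e ∈ M, v ∈ e

instance {V : Type*} [DecidableEq V] (M : Finset (Sym2 V)) : DecidablePred (Covered M) :=
  fun v => decidable_of_iff (∃ e ∈ M, v ∈ e) Iff.rfl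

/-- `degE B w` is the number of edges of `B` incident to the vertex `w`. -/
def degE {V : Type*} [DecidableEq V] (B : Finset (Sym2 V)) (w : V) : ℕ :=
  (B.filter fun e => w ∈ e).card

universe u

open Classical in
lemma tutte_option {W : Type u} [Fintype W] (F : SimpleGraph W)
    (h : ¬ ∃ P : F.Subgraph, P.IsPerfectMatching) :
    ∃ (ι : Type u) (_ : Fintype ι) (c : W → Option ι),
      (∀ u v i j, F.Adj u v → c u = some i → c v = some j → i = j) ∧
      (Finset.univ.filter fun w => c w = none).card <
        (Finset.univ.filter fun i : ι =>
          Odd (Finset.univ.filter fun w => c w = some i).card).card := by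
  rw [SimpleGraph.tutte] at h
  push Not at h
  obtain ⟨u, hu⟩ := h
  unfold SimpleGraph.IsTutteViolator at hu
  set D := ((⊤ : F.Subgraph).deleteVerts u).coe with hD
  have hmem : ∀ w, w ∉ u → w ∈ ((⊤ : F.Subgraph).deleteVerts u).verts := by
    intro w hw; simpa using hw
  have hmem' : ∀ w, w ∈ ((⊤ : F.Subgraph).deleteVerts u).verts → w ∉ u := by
    intro w hw; simpa using hw
  let c : W → Option D.ConnectedComponent := fun w =>
    if hw : w ∈ u then none else some (D.connectedComponentMk ⟨w, hmem w hw⟩)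
  refine ⟨D.ConnectedComponent, Fintype.ofFinite _, c, ?_, ?_⟩
  · intro x y i j hxy hi hj
    by_cases hx : x ∈ u
    · simp [c, hx] at hi
    by_cases hy : y ∈ u
    · simp [c, hy] at hj
    simp only [c, hx, hy, dif_neg, not_false_eq_true, Option.some.injEq] at hi hj
    rw [← hi, ← hj, SimpleGraph.ConnectedComponent.eq]
    apply SimpleGraph.Adj.reachable
    simp [hD, hx, hy, hxy]
  · have h1 : (Finset.univ.filter fun w => c w = none).card = u.ncard := by
      rw [← Set.ncard_coe_finset]
      congr 1
      ext w
      by_cases hw : w ∈ u <;> simp [c, hw]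
    have h2 : ∀ i, (Finset.univ.filter fun w => c w = some i).card = i.supp.ncard := by
      intro i
      rw [← Set.ncard_image_of_injective _ Subtype.val_injective, ← Set.ncard_coe_finset]
      congr 1
      ext w
      by_cases hw : w ∈ u
      · simp [c, hw]
      · simp [c, hw]
    rw [h1]
    refine lt_of_lt_of_le hu (le_of_eq ?_)
    rw [← Set.ncard_coe_finset]
    congr 1
    ext i
    simp [h2]

lemma pair_card {V : Type*} [Fintype V] [DecidableEq V] (E : Finset (Sym2 V))
    (hE : ∀ e ∈ E, ¬ e.IsDiag) :
    (Finset.univ.filter fun p : V × V => s(p.1, p.2) ∈ E).card = 2 * E.card := by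
  rw [Finset.card_eq_sum_card_fiberwise (f := fun p : V × V => s(p.1, p.2)) (t := E)]
  · rw [mul_comm, ← smul_eq_mul, ← Finset.sum_const]
    apply Finset.sum_congr rfl
    intro e he
    induction e with | _ x y
    have hxy : x ≠ y := by simpa using hE _ he
    have : (Finset.filter (fun p : V × V => s(p.1, p.2) = s(x, y))
      (Finset.univ.filter fun p : V × V => s(p.1, p.2) ∈ E)) = {(x, y), (y, x)} := by
      ext ⟨p, q⟩
      simp only [Finset.mem_filter, Finset.mem_univ, true_and, Finset.mem_insert,
        Finset.mem_singleton, Prod.mk.injEq]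
      rw [Sym2.eq_iff]
      constructor
      · exact fun h => h.2
      · rintro (⟨rfl, rfl⟩ | ⟨rfl, rfl⟩)
        · exact ⟨he, by simp⟩
        · exact ⟨by rwa [Sym2.eq_swap], by simp⟩
    rw [this, Finset.card_pair]
    simp [hxy]
  · intro p hp
    simpa using hp

lemma IsMatching.not_diag {V : Type*} {G : SimpleGraph V} {N : Finset (Sym2 V)}
    (h : IsMatching G N) : ∀ e ∈ N, ¬ e.IsDiag := fun e he => G.not_isDiag_of_mem_edgeSet (h.1 e he)

lemma IsMatching.right_unique {V : Type*} {G : SimpleGraph V} {N : Finset (Sym2 V)}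
    (h : IsMatching G N) {u v w : V} (h1 : s(u, v) ∈ N) (h2 : s(u, w) ∈ N) : v = w := by
  by_contra hne
  refine h.2 _ h1 _ h2 ?_ u (by simp) (by simp)
  intro h3
  rw [Sym2.eq_iff] at h3
  rcases h3 with h3 | h3
  · exact hne h3.2
  · exact hne (h3.2.trans h3.1)

open Classical in
lemma tutte_berge_s8 {V : Type u} [Fintype V] [DecidableEq V] (F : SimpleGraph V) :
    ∃ N, IsMatching F N ∧ ∃ (ι : Type u) (_ : Fintype ι) (c : V → Option ι),
      (∀ u v i j, F.Adj u v → c u = some i → c v = some j → i = j) ∧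
      (Finset.univ.filter fun w => c w = none).card +
        ∑ i : ι, (Finset.univ.filter fun w => c w = some i).card / 2 ≤ N.card := by
  obtain ⟨N, hN, hmax⟩ := Finset.exists_max_image
    (Finset.univ.filter fun N : Finset (Sym2 V) => IsMatching F N) Finset.card
    ⟨∅, Finset.mem_filter.2 ⟨Finset.mem_univ _, by simp [IsMatching]⟩⟩
  simp only [Finset.mem_filter, Finset.mem_univ, true_and] at hN hmax
  refine ⟨N, hN, ?_⟩
  by_cases hsmall : Fintype.card V ≤ 2 * N.card + 1
  · refine ⟨ULift Unit, inferInstance, fun _ => some ⟨()⟩, by simp, ?_⟩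
    simp
    omega
  obtain ⟨d, hd⟩ : ∃ d, Fintype.card V = 2 * N.card + 2 + d := ⟨_, (Nat.add_sub_of_le (by omega)).symm⟩
  let F' : SimpleGraph (V ⊕ Fin d) :=
    { Adj := fun x y => match x, y with
        | .inl a, .inl b => F.Adj a b
        | x, y => x ≠ y
      symm := ⟨by
        rintro (a | a) (b | b) h
        · exact SimpleGraph.Adj.symm (G := F) h
        · exact h.symm
        · exact h.symm
        · exact h.symm⟩
      loopless := ⟨by
        rintro (a | a) h
        · exact F.loopless.irrefl _ h
        · exact h rfl⟩ }
  have hll : ∀ a b, F'.Adj (.inl a) (.inl b) ↔ F.Adj a b := fun a b => Iff.rfl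
  have hr : ∀ a b, F'.Adj (.inr a) b ↔ .inr a ≠ b := fun a b => by cases b <;> exact Iff.rfl
  have hnp : ¬ ∃ P : F'.Subgraph, P.IsPerfectMatching := by
    rintro ⟨P, hP⟩
    rw [SimpleGraph.Subgraph.isPerfectMatching_iff] at hP
    choose f hf hf' using hP
    let N2 : Finset (Sym2 V) := Finset.univ.filter fun e =>
      ∃ a b, e = s(a, b) ∧ P.Adj (.inl a) (.inl b)
    have hN2mem : ∀ a b, s(a, b) ∈ N2 ↔ P.Adj (.inl a) (.inl b) := by
      intro a b
      simp only [N2, Finset.mem_filter, Finset.mem_univ, true_and]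
      constructor
      · rintro ⟨x, y, h1, h2⟩
        rw [Sym2.eq_iff] at h1
        rcases h1 with ⟨rfl, rfl⟩ | ⟨rfl, rfl⟩
        · exact h2
        · exact h2.symm
      · intro h; exact ⟨a, b, rfl, h⟩
    have huniq : ∀ x y z, P.Adj x y → P.Adj x z → y = z := fun x y z h1 h2 =>
      (hf' x y h1).trans (hf' x z h2).symm
    have hN2 : IsMatching F N2 := by
      refine ⟨?_, ?_⟩
      · intro e he
        induction e with | _ a b
        rw [hN2mem] at he
        exact (hll _ _).1 he.adj_sub
      · intro e he e' he' hne v hv hv'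
        obtain ⟨a, rfl⟩ := hv
        obtain ⟨b, rfl⟩ := hv'
        rw [hN2mem] at he he'
        have := huniq _ _ _ he he'
        simp at this
        exact hne (by rw [this])
    have h1 := hmax _ hN2
    have h2 := pair_card N2 hN2.not_diag
    have h3 : (Finset.univ.filter fun v : V => ∃ b, f (.inl v) = .inl b).card ≤
        (Finset.univ.filter fun p : V × V => s(p.1, p.2) ∈ N2).card := by
      refine Finset.card_le_card_of_surjOn Prod.fst ?_
      intro v hv
      simp at hv
      obtain ⟨b, hb⟩ := hv
      refine ⟨(v, b), ?_, rfl⟩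
      simp only [Finset.coe_filter, Finset.mem_univ, true_and, Set.mem_ofPred_eq, hN2mem]
      rw [← hb]; exact hf _
    have h4 : (Finset.univ.filter fun v : V => ¬ ∃ b, f (.inl v) = .inl b).card ≤ d := by
      have : (Finset.univ.filter fun v : V => ¬ ∃ b, f (.inl v) = .inl b).card ≤
        (Finset.univ.image (Sum.inr : Fin d → V ⊕ Fin d)).card := by
        refine Finset.card_le_card_of_injOn (fun v => f (.inl v)) ?_ ?_
        · intro v hv
          simp only [Finset.coe_filter, Finset.mem_univ, true_and, Set.mem_ofPred_eq] at hv
          cases hfv : f (.inl v) with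
          | inl b => exact absurd ⟨b, hfv⟩ hv
          | inr b => simp [hfv]
        · intro v _ w _ hvw
          simp only at hvw
          have e1 := (hf (.inl v)).symm
          have e2 := (hf (.inl w)).symm
          rw [← hvw] at e2
          simpa using huniq _ _ _ e1 e2
      refine this.trans (Finset.card_image_le.trans (by simp))
    have h5 := Finset.card_filter_add_card_filter_not (s := (Finset.univ : Finset V))
      (fun v : V => ∃ b, f (.inl v) = .inl b)
    rw [Finset.card_univ] at h5
    omega
  obtain ⟨ι, hι, c, hc, hodd⟩ := tutte_option F' hnp
  have hall : ∀ j, c (.inr j) = none := by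
    intro j
    by_contra hj
    obtain ⟨i, hi⟩ := Option.ne_none_iff_exists'.1 hj
    have hsame : ∀ w i', c w = some i' → i' = i := by
      intro w i' hw
      by_cases hwj : Sum.inr j = w
      · subst hwj; rw [hi] at hw; simpa using hw.symm
      · exact (hc _ _ _ _ ((hr _ _).2 hwj) hi hw).symm
    have hsub : (Finset.univ.filter fun i : ι =>
          Odd (Finset.univ.filter fun w => c w = some i).card) ⊆ {i} := by
      intro i' hi'
      simp only [Finset.mem_filter, Finset.mem_univ, true_and] at hi'
      obtain ⟨w, hw⟩ := Finset.card_pos.1 hi'.pos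
      simp at hw
      simpa using hsame _ _ hw
    have hle := Finset.card_le_card hsub
    rw [Finset.card_singleton] at hle
    have h0 : (Finset.univ.filter fun w => c w = none).card = 0 := by omega
    have hne : 0 < (Finset.univ.filter fun i : ι =>
          Odd (Finset.univ.filter fun w => c w = some i).card).card := by omega
    obtain ⟨i', hi'⟩ := Finset.card_pos.1 hne
    have := hsub hi'
    simp only [Finset.mem_singleton] at this
    subst this
    simp only [Finset.mem_filter, Finset.mem_univ, true_and] at hi'
    have huniv : (Finset.univ.filter fun w => c w = some i') = Finset.univ := by
      ext w
      simp only [Finset.mem_filter, Finset.mem_univ, true_and, iff_true]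
      rw [Finset.card_eq_zero] at h0
      have hw : c w ≠ none := fun h => by
        have : w ∈ (Finset.univ.filter fun w => c w = none) := by simp [h]
        rw [h0] at this; simp at this
      obtain ⟨i, hi⟩ := Option.ne_none_iff_exists'.1 hw
      rw [hi, hsame _ _ hi]
    rw [huniv, Finset.card_univ, Fintype.card_sum, Fintype.card_fin, hd] at hi'
    rcases hi' with ⟨m, hm⟩
    omega
  refine ⟨ι, hι, fun v => c (.inl v), fun u v i j h => hc _ _ _ _ ((hll _ _).2 h), ?_⟩
  have hcard : ∀ o : Option ι, (Finset.univ.filter fun w => c w = o).card =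
      (Finset.univ.filter fun v => c (.inl v) = o).card + if o = none then d else 0 := by
    intro o
    rw [Finset.card_filter, Fintype.sum_sum_type, ← Finset.card_filter]
    congr 1
    simp only [hall]
    cases o <;> simp
  have hn := hcard none
  have hs : ∀ i, (Finset.univ.filter fun w => c w = some i).card =
      (Finset.univ.filter fun v => c (.inl v) = some i).card := fun i => by simpa using hcard (some i)
  simp only [if_true] at hn
  have htot : Fintype.card V = (Finset.univ.filter fun v : V => c (.inl v) = none).card +
      ∑ i : ι, (Finset.univ.filter fun v : V => c (.inl v) = some i).card := by
    rw [← Fintype.sum_option (f := fun o => (Finset.univ.filter fun v : V => c (.inl v) = o).card),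
      ← Finset.card_univ]
    exact Finset.card_eq_sum_card_fiberwise (by simp)
  simp only [hs] at hodd
  rw [hn, Finset.card_filter (fun i : ι => Odd _)] at hodd
  have hsum : ∑ i : ι, (Finset.univ.filter fun v : V => c (.inl v) = some i).card =
      2 * (∑ i : ι, (Finset.univ.filter fun v : V => c (.inl v) = some i).card / 2) +
      ∑ i : ι, if Odd (Finset.univ.filter fun v : V => c (.inl v) = some i).card then 1 else 0 := by
    rw [Finset.mul_sum, ← Finset.sum_add_distrib]
    apply Finset.sum_congr rfl
    intro i _
    split_ifs with h
    · rcases h with ⟨m, hm⟩; omega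
    · rw [Nat.not_odd_iff_even] at h
      rcases h with ⟨m, hm⟩; omega
  show (Finset.univ.filter fun v : V => c (.inl v) = none).card +
    ∑ i : ι, (Finset.univ.filter fun v : V => c (.inl v) = some i).card / 2 ≤ _
  omega

lemma match_row {V : Type*} [Fintype V] [DecidableEq V] {G : SimpleGraph V} {N : Finset (Sym2 V)}
    (h : IsMatching G N) (u : V) (f : V → ℝ) (r : ℝ) (hr : 0 ≤ r)
    (hf : ∀ v, s(u, v) ∈ N → f v ≤ r) :
    ∑ v, (if s(u, v) ∈ N then f v else 0) ≤ r := by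
  by_cases hex : ∃ v, s(u, v) ∈ N
  · obtain ⟨v, hv⟩ := hex
    rw [Finset.sum_eq_single v]
    · simpa [hv] using hf v hv
    · intro w _ hw
      rw [if_neg]
      intro hw'
      exact hw (h.right_unique hw' hv)
    · simp
  · push Not at hex
    simp [hex, hr]

lemma match_K {V : Type*} [Fintype V] [DecidableEq V] {G : SimpleGraph V} {N : Finset (Sym2 V)}
    (h : IsMatching G N) (K : Finset V) :
    ∑ u ∈ K, ∑ v ∈ K, (if s(u, v) ∈ N then (1 : ℝ) else 0) ≤ 2 * ((K.card / 2 : ℕ) : ℝ) := by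
  classical
  have h1 : ∑ u ∈ K, ∑ v ∈ K, (if s(u, v) ∈ N then (1 : ℝ) else 0) =
      (((K ×ˢ K).filter fun p : V × V => s(p.1, p.2) ∈ N).card : ℝ) := by
    rw [← Finset.sum_product', Finset.sum_boole]
  have h2 : ((K ×ˢ K).filter fun p : V × V => s(p.1, p.2) ∈ N) =
      Finset.univ.filter fun p : V × V => s(p.1, p.2) ∈ N.filter fun e => ∀ v ∈ e, v ∈ K := by
    ext ⟨u, v⟩
    simp
    tauto
  have h3 := pair_card (N.filter fun e => ∀ v ∈ e, v ∈ K)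
    (fun e he => h.not_diag e (Finset.mem_filter.1 he).1)
  rw [← h2] at h3
  have h4 : ((K ×ˢ K).filter fun p : V × V => s(p.1, p.2) ∈ N).card ≤ K.card := by
    refine Finset.card_le_card_of_injOn Prod.fst ?_ ?_
    · intro p hp
      simp at hp
      exact hp.1.1
    · rintro ⟨u, v⟩ hp ⟨u', v'⟩ hq huu
      simp at hp hq huu
      subst huu
      rw [h.right_unique hp.2 hq.2]
  rw [h1]
  norm_cast
  omega

lemma row_deg {V : Type*} [Fintype V] [DecidableEq V] (B : Finset (Sym2 V)) (u : V) (l : ℝ) :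
    ∑ v, (if s(u, v) ∈ B then l else 0) = l * degE B u := by
  have : (Finset.univ.filter fun v => s(u, v) ∈ B).card = degE B u := by
    unfold degE
    refine Finset.card_bij (fun v _ => s(u, v)) ?_ ?_ ?_
    · intro v hv; simpa using hv
    · intro v _ w _ hvw
      rcases Sym2.eq_iff.1 hvw with h | h
      · exact h.2
      · exact h.2.trans h.1
    · intro e he
      simp only [Finset.mem_filter] at he
      obtain ⟨he, v, rfl⟩ := he
      exact ⟨v, by simpa using he, rfl⟩
  rw [← this, ← Finset.sum_filter, Finset.sum_const, nsmul_eq_mul, mul_comm]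

lemma upper {V : Type*} [Fintype V] [DecidableEq V] (F : SimpleGraph V) (W : V → V → ℝ)
    (η : ℝ) (hη0 : 0 ≤ η) (hη1 : η ≤ 1)
    (hW0 : ∀ u v, 0 ≤ W u v) (hWF : ∀ u v, W u v ≠ 0 → F.Adj u v)
    (hsymm : ∀ u v, W u v = W v u) (hrow : ∀ u, ∑ v, W u v ≤ 1)
    (hK : ∀ K : Finset V, η * ∑ u ∈ K, ∑ v ∈ K, W u v ≤ 2 * ((K.card / 2 : ℕ) : ℝ)) :
    ∃ N, IsMatching F N ∧ η * ∑ u, ∑ v, W u v ≤ 2 * (N.card : ℝ) := by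
  classical
  obtain ⟨N, hN, ι, hι, c, hc, hcard⟩ := tutte_berge_s8 F
  refine ⟨N, hN, ?_⟩
  have hpt : ∀ u v, W u v ≤ (if c u = none then W u v else 0) + (if c v = none then W u v else 0) +
      ∑ i, (if c u = some i then (if c v = some i then W u v else 0) else 0) := by
    intro u v
    have hs : 0 ≤ ∑ i, (if c u = some i then (if c v = some i then W u v else 0) else 0) := by
      apply Finset.sum_nonneg
      intro i _
      split_ifs <;> simp [hW0]
    have h0 := hW0 u v
    cases hu : c u with
    | none =>
      simp only [if_true, reduceCtorEq, if_false, Finset.sum_const_zero]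
      split_ifs <;> linarith
    | some i =>
      cases hv : c v with
      | none =>
        simp
      | some j =>
        by_cases hz : W u v = 0
        · simp [hz]
        · have := hc _ _ _ _ (hWF _ _ hz) hu hv
          subst this
          simp
  have e1 : ∑ u, ∑ v, (if c u = none then W u v else 0) ≤
      ((Finset.univ.filter fun w => c w = none).card : ℝ) := by
    rw [← Finset.sum_boole]
    apply Finset.sum_le_sum
    intro u _
    split_ifs
    · exact hrow u
    · simp
  have e2 : ∑ u, ∑ v, (if c v = none then W u v else 0) ≤
      ((Finset.univ.filter fun w => c w = none).card : ℝ) := by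
    rw [Finset.sum_comm]
    simp only [hsymm]
    refine le_trans (le_of_eq ?_) e1
    apply Finset.sum_congr rfl
    intro u _
    apply Finset.sum_congr rfl
    intro v _
    rw [hsymm]
  have e3 : ∑ u, ∑ v, ∑ i, (if c u = some i then (if c v = some i then W u v else 0) else 0) =
      ∑ i, ∑ u ∈ Finset.univ.filter (fun w => c w = some i),
        ∑ v ∈ Finset.univ.filter (fun w => c w = some i), W u v := by
    simp_rw [Finset.sum_filter]
    have : ∀ u, ∑ v, ∑ i, (if c u = some i then (if c v = some i then W u v else 0) else 0) =
      ∑ i, ∑ v, (if c u = some i then (if c v = some i then W u v else 0) else 0) :=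
      fun u => Finset.sum_comm
    simp_rw [this]
    rw [Finset.sum_comm]
    apply Finset.sum_congr rfl
    intro i _
    apply Finset.sum_congr rfl
    intro u _
    split_ifs <;> simp
  have e4 : ∑ u, ∑ v, W u v ≤ ∑ u, ∑ v, ((if c u = none then W u v else 0) +
      (if c v = none then W u v else 0) +
      ∑ i, (if c u = some i then (if c v = some i then W u v else 0) else 0)) :=
    Finset.sum_le_sum fun u _ => Finset.sum_le_sum fun v _ => hpt u v
  simp_rw [Finset.sum_add_distrib] at e4
  rw [e3] at e4
  have e5 : η * ∑ i, ∑ u ∈ Finset.univ.filter (fun w => c w = some i),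
        ∑ v ∈ Finset.univ.filter (fun w => c w = some i), W u v ≤
      2 * ∑ i, (((Finset.univ.filter fun w => c w = some i).card / 2 : ℕ) : ℝ) := by
    rw [Finset.mul_sum, Finset.mul_sum]
    exact Finset.sum_le_sum fun i _ => hK _
  have e6 : ((Finset.univ.filter fun w => c w = none).card : ℝ) +
        ∑ i : ι, (((Finset.univ.filter fun w => c w = some i).card / 2 : ℕ) : ℝ) ≤ N.card := by
    exact_mod_cast hcard
  set n0 := ((Finset.univ.filter fun w => c w = none).card : ℝ)
  have hn0 : 0 ≤ n0 := Nat.cast_nonneg _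
  nlinarith [mul_le_mul_of_nonneg_left e4 hη0, mul_le_mul_of_nonneg_left e1 hη0,
    mul_le_mul_of_nonneg_left e2 hη0, mul_le_mul_of_nonneg_right hη1 hn0]

/-- arithmetic for one class -/
lemma class_bound (ε l S : ℝ) (hε0 : 0 < ε) (hε1 : ε < 1) (hl : l ≤ ε ^ 3) (n : ℕ)
    (h1 : S ≤ n) (h2 : S ≤ 2 * ((n / 2 : ℕ) : ℝ) + l * (n * (n - 1))) :
    (1 - ε) * S ≤ 2 * ((n / 2 : ℕ) : ℝ) := by
  rcases Nat.even_or_odd' n with ⟨r, rfl | rfl⟩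
  · have : 2 * r / 2 = r := by omega
    rw [this]
    push_cast at h1
    have : (0 : ℝ) ≤ r := Nat.cast_nonneg _
    nlinarith
  · have : (2 * r + 1) / 2 = r := by omega
    rw [this] at h2 ⊢
    push_cast at h1 h2
    have hr : (0 : ℝ) ≤ r := Nat.cast_nonneg _
    by_cases hc : (1 - ε) * (2 * r + 1) ≤ 2 * (r : ℝ)
    · nlinarith
    · push Not at hc
      have hc' : ε * (2 * r + 1) ≤ 1 := by nlinarith
      have h3 : l * ((2 * r + 1) * (2 * r + 1 - 1)) ≤ ε ^ 2 * (2 * r) := by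
        calc l * ((2 * r + 1) * (2 * r + 1 - 1)) ≤ ε ^ 3 * ((2 * r + 1) * (2 * r)) := by
              rw [add_sub_cancel_right]
              exact mul_le_mul_of_nonneg_right hl (by positivity)
          _ = ε ^ 2 * (2 * r) * (ε * (2 * r + 1)) := by ring
          _ ≤ ε ^ 2 * (2 * r) * 1 := mul_le_mul_of_nonneg_left hc' (by positivity)
          _ = _ := by ring
      have h4 : S ≤ 2 * r + ε ^ 2 * (2 * r) := by linarith
      have h5 : (1 - ε) * S ≤ (1 - ε) * (2 * r + ε ^ 2 * (2 * r)) :=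
        mul_le_mul_of_nonneg_left h4 (by linarith)
      have h6 : 0 ≤ (2 * r) * (ε * (1 - ε) + ε ^ 3) := by
        have : 0 ≤ ε * (1 - ε) := mul_nonneg hε0.le (by linarith)
        positivity
      nlinarith

lemma final_arith (ε b : ℝ) (hε0 : 0 < ε) (hε1 : ε < 1) (hb : b = 1 + Real.sqrt 2)
    (k C : ℝ) (hk : k ≥ 1 / (b * ε ^ 3)) (hC1 : k * b ≤ C) (hC2 : C ≤ k * b + 1)
    (m n L R : ℝ) (hm : 0 ≤ m) (hn : 0 ≤ n)
    (hL : k / C * (2 * n - 2 * m) ≤ (1 + k / C) * L)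
    (hR : (1 - ε) * (2 * (1 - k / C) * m + 2 * L) ≤ 2 * R) :
    R ≥ (1 - ε) ^ 3 * (2 - Real.sqrt 2) * n := by
  have hs : Real.sqrt 2 ^ 2 = 2 := Real.sq_sqrt (by norm_num)
  have hs0 : 1 < Real.sqrt 2 := by
    rw [Real.lt_sqrt] <;> norm_num
  have hs2 : Real.sqrt 2 < 2 := by
    rw [Real.sqrt_lt'] <;> norm_num
  set s := Real.sqrt 2
  have hb0 : 0 < b := by linarith
  have hkb : 1 ≤ k * b * ε ^ 3 := by
    rw [ge_iff_le, div_le_iff₀ (by positivity)] at hk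
    linarith
  have hk0 : 0 < k := lt_of_lt_of_le (by positivity) hk
  have hC0 : 0 < C := lt_of_lt_of_le (by positivity) hC1
  set a := k / C with ha
  have haC : a * C = k := div_mul_cancel₀ _ hC0.ne'
  have ha0 : 0 < a := div_pos hk0 hC0
  have hab : a * b ≤ 1 := by
    have : a * b = k * b / C := by rw [ha]; ring
    rw [this, div_le_one hC0]; exact hC1
  have hbs : b * (s - 1) = 1 := by rw [hb]; nlinarith
  have has : a ≤ s - 1 := by nlinarith
  have hlow : (1 - ε) * (s - 1) ≤ a := by
    rw [ha, le_div_iff₀ hC0]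
    have h1 : (1 - ε) * (s - 1) * C ≤ (1 - ε) * (s - 1) * (k * b + 1) :=
      mul_le_mul_of_nonneg_left hC2 (mul_nonneg (by linarith) (by linarith))
    have h2 : (1 - ε) * (s - 1) * (k * b + 1) = (1 - ε) * (k + (s - 1)) := by
      calc _ = (1 - ε) * (k * (b * (s - 1)) + (s - 1)) := by ring
        _ = _ := by rw [hbs, mul_one]
    have h3 : s - 1 ≤ k * ε ^ 3 := by
      have : (s - 1) * 1 ≤ (s - 1) * (k * b * ε ^ 3) :=
        mul_le_mul_of_nonneg_left hkb (by linarith)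
      calc s - 1 ≤ (s - 1) * (k * b * ε ^ 3) := by linarith
        _ = k * ε ^ 3 * (b * (s - 1)) := by ring
        _ = _ := by rw [hbs, mul_one]
    have h4 : k * ε ^ 3 ≤ k * ε := by
      apply mul_le_mul_of_nonneg_left _ hk0.le
      calc ε ^ 3 ≤ ε ^ 1 := pow_le_pow_of_le_one hε0.le hε1.le (by norm_num)
        _ = ε := pow_one _
    rw [h2] at h1
    nlinarith
  have hc : (1 - ε) * (2 - s) * (1 + a) ≤ 2 * a := by
    have e1 : (2 - s) * s = 2 * (s - 1) := by nlinarith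
    have e2 : (1 - ε) * (s - 1) * (1 + a) ≤ a * s := by
      nlinarith [mul_pos ha0 hε0]
    have e3 : s * ((1 - ε) * (2 - s) * (1 + a)) ≤ s * (2 * a) := by
      calc s * ((1 - ε) * (2 - s) * (1 + a)) = (1 - ε) * (1 + a) * ((2 - s) * s) := by ring
        _ = 2 * ((1 - ε) * (s - 1) * (1 + a)) := by rw [e1]; ring
        _ ≤ _ := by linarith
    exact le_of_mul_le_mul_left e3 (by linarith)
  have hq : 0 ≤ 1 - 2 * a - a ^ 2 := by nlinarith
  have hT : (1 - ε) * (2 - s) * n ≤ (1 - a) * m + L := by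
    have e1 : (1 + a) * ((1 - ε) * (2 - s) * n) ≤ (1 + a) * ((1 - a) * m + L) := by
      have := mul_le_mul_of_nonneg_right hc hn
      have := mul_nonneg hq hm
      nlinarith
    exact le_of_mul_le_mul_left e1 (by linarith)
  have h7 : (1 - ε) * ((1 - ε) * (2 - s) * n) ≤ R := by
    have := mul_le_mul_of_nonneg_left hT (by linarith : 0 ≤ 1 - ε)
    linarith
  have h8 : 0 ≤ (1 - ε) ^ 2 * (2 - s) * n * ε := by
    have : 0 ≤ 2 - s := by linarith
    positivity
  nlinarith

lemma no_uncovered_edge {V : Type*} [DecidableEq V] {G : SimpleGraph V} {M : Finset (Sym2 V)}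
    (hM : IsMaximalMatching G M) {u v : V} (h : G.Adj u v) (hu : ¬ Covered M u) : Covered M v := by
  by_contra hv
  have hnot : ∀ e ∈ M, ∀ w ∈ e, w ∉ s(u, v) := by
    intro e he w hw hw'
    rw [Sym2.mem_iff] at hw'
    rcases hw' with rfl | rfl
    · exact hu ⟨e, he, hw⟩
    · exact hv ⟨e, he, hw⟩
  refine hM.2 s(u, v) h (fun hm => hu ⟨_, hm, by simp⟩) ⟨?_, ?_⟩
  · intro e he
    rcases Finset.mem_insert.1 he with rfl | he
    · exact h
    · exact hM.1.1 e he
  · intro e he f hf hne w hw hw'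
    rcases Finset.mem_insert.1 he with rfl | he <;> rcases Finset.mem_insert.1 hf with rfl | hf
    · exact hne rfl
    · exact hnot f hf w hw' hw
    · exact hnot e he w hw hw'
    · exact hM.1.2 e he f hf hne w hw hw'

lemma core {V : Type*} [Fintype V] [DecidableEq V]
    (ε b : ℝ) (hε0 : 0 < ε) (hε1 : ε < 1) (hb : b = 1 + Real.sqrt 2)
    (k : ℕ) (hk : (k : ℝ) ≥ 1 / (b * ε ^ 3))
    (G : SimpleGraph V) (M : Finset (Sym2 V)) (hM : IsMaximalMatching G M)
    (B : Finset (Sym2 V))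
    (hBsub : ∀ e ∈ B, e ∈ G.edgeSet ∧ (∃ v ∈ e, Covered M v) ∧ (∃ v ∈ e, ¬ Covered M v))
    (hcapA : ∀ u : V, Covered M u → degE B u ≤ k)
    (hcapB : ∀ v : V, ¬ Covered M v → degE B v ≤ ⌈(k : ℝ) * b⌉₊)
    (hmax : ∀ u v : V, G.Adj u v → Covered M u → ¬ Covered M v → s(u, v) ∉ B →
      degE B u = k ∨ degE B v = ⌈(k : ℝ) * b⌉₊)
    (N' : Finset (Sym2 V)) (hN' : IsMatching G N') :
    ∃ N : Finset (Sym2 V), N ⊆ M ∪ B ∧ IsMatching G N ∧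
        (N.card : ℝ) ≥ (1 - ε) ^ 3 * (2 - Real.sqrt 2) * N'.card := by
  have hb1 : 1 ≤ b := by rw [hb]; linarith [Real.sqrt_nonneg 2]
  have hkb : 1 ≤ k * b * ε ^ 3 := by
    rw [ge_iff_le, div_le_iff₀ (by positivity)] at hk
    linarith
  have hk0 : (0 : ℝ) < k := lt_of_lt_of_le (by positivity) hk
  set C := ⌈(k : ℝ) * b⌉₊ with hCdef
  have hC1 : (k : ℝ) * b ≤ C := Nat.le_ceil _
  have hC2 : (C : ℝ) ≤ k * b + 1 := (Nat.ceil_lt_add_one (by positivity)).le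
  have hkC : (k : ℝ) ≤ C := by nlinarith
  have hC0 : (0 : ℝ) < C := lt_of_lt_of_le hk0 hkC
  obtain ⟨lam, hlam⟩ : ∃ lam : ℝ, lam = 1 / C := ⟨_, rfl⟩
  have hlam0 : 0 < lam := by rw [hlam]; positivity
  have hlamC : lam * C = 1 := by rw [hlam]; field_simp
  have hlamε : lam ≤ ε ^ 3 := by
    rw [hlam, div_le_iff₀ hC0]
    have : (0 : ℝ) ≤ ε ^ 3 := by positivity
    nlinarith
  obtain ⟨a, ha⟩ : ∃ a : ℝ, a = k / C := ⟨_, rfl⟩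
  have hak : lam * k = a := by rw [ha, hlam]; ring
  have ha0 : 0 < a := by rw [ha]; positivity
  have ha1 : a ≤ 1 := by rw [ha]; exact div_le_one_of_le₀ hkC hC0.le
  have hBxor : ∀ u v, s(u, v) ∈ B → (Covered M u ↔ ¬ Covered M v) := by
    intro u v h
    obtain ⟨_, ⟨x, hx, hx'⟩, ⟨y, hy, hy'⟩⟩ := hBsub _ h
    rw [Sym2.mem_iff] at hx hy
    rcases hx with rfl | rfl <;> rcases hy with rfl | rfl <;> tauto
  -- residual capacities
  let cap : V → ℝ := fun w => if Covered M w then a else 1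
  let rho : V → ℝ := fun w => cap w - lam * degE B w
  have hrho0 : ∀ w, 0 ≤ rho w := by
    intro w
    by_cases hw : Covered M w
    · have h1 : (degE B w : ℝ) ≤ k := by exact_mod_cast hcapA w hw
      have := mul_le_mul_of_nonneg_left h1 hlam0.le
      simp only [rho, cap, hw, if_true]; linarith
    · have h1 : (degE B w : ℝ) ≤ C := by exact_mod_cast hcapB w hw
      have := mul_le_mul_of_nonneg_left h1 hlam0.le
      simp only [rho, cap, hw, if_false]; linarith
  have hrhoa : ∀ w, Covered M w → rho w ≤ a := by
    intro w hw
    have : 0 ≤ lam * degE B w := by positivity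
    simp only [rho, cap, hw, if_true]; linarith
  let Q := B ∩ N'
  have hQ : IsMatching G Q :=
    ⟨fun e he => hN'.1 e (Finset.mem_inter.1 he).2,
     fun e he f hf => hN'.2 e (Finset.mem_inter.1 he).2 f (Finset.mem_inter.1 hf).2⟩
  let del : V → V → ℝ := fun u v => if s(u, v) ∈ Q then min (rho u) (rho v) else 0
  let X : V → V → ℝ := fun u v => (if s(u, v) ∈ B then lam else 0) + del u v
  let W : V → V → ℝ := fun u v => (if s(u, v) ∈ M then 1 - a else 0) + X u v
  let ell : V → ℝ := fun u => ∑ v, X u v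
  have hdel0 : ∀ u v, 0 ≤ del u v := by
    intro u v
    simp only [del]
    split_ifs
    · exact le_min (hrho0 _) (hrho0 _)
    · exact le_rfl
  have hdelsymm : ∀ u v, del u v = del v u := by
    intro u v; simp only [del, Sym2.eq_swap (a := u) (b := v), min_comm]
  have hdela : ∀ u v, del u v ≤ if s(u, v) ∈ Q then a else 0 := by
    intro u v
    simp only [del]
    split_ifs with h
    · by_cases hu : Covered M u
      · exact (min_le_left _ _).trans (hrhoa _ hu)
      · have := hBxor u v (Finset.mem_inter.1 h).1
        exact (min_le_right _ _).trans (hrhoa _ (by tauto))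
    · exact le_rfl
  have hX0 : ∀ u v, 0 ≤ X u v := by
    intro u v
    have := hdel0 u v
    simp only [X]
    split_ifs <;> linarith
  have hXB : ∀ u v, s(u, v) ∉ B → X u v = 0 := by
    intro u v h
    simp [X, del, Q, h]
  have hXsymm : ∀ u v, X u v = X v u := by
    intro u v; simp only [X, hdelsymm u v, Sym2.eq_swap (a := u) (b := v)]
  have hW0 : ∀ u v, 0 ≤ W u v := by
    intro u v
    have := hX0 u v
    simp only [W]
    split_ifs <;> linarith
  have hWsymm : ∀ u v, W u v = W v u := by
    intro u v; simp only [W, hXsymm u v, Sym2.eq_swap (a := u) (b := v)]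
  have hell : ∀ u, ell u = lam * degE B u + ∑ v, del u v := by
    intro u
    simp only [ell, X, Finset.sum_add_distrib, row_deg]
  have hell0 : ∀ u, 0 ≤ ell u := fun u => Finset.sum_nonneg fun v _ => hX0 u v
  have hellcap : ∀ u, ell u ≤ cap u := by
    intro u
    have := match_row hQ u (fun v => min (rho u) (rho v)) (rho u) (hrho0 u)
      (fun v _ => min_le_left _ _)
    rw [hell]
    simp only [del]
    simp only [rho] at this ⊢
    linarith
  have hrow : ∀ u, ∑ v, W u v ≤ 1 := by
    intro u
    have h1 : ∑ v, W u v = ∑ v, (if s(u, v) ∈ M then 1 - a else 0) + ell u := by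
      simp only [W, Finset.sum_add_distrib, ell]
    have h2 := hellcap u
    rw [h1]
    by_cases hu : Covered M u
    · have h3 := match_row hM.1 u (fun _ => 1 - a) (1 - a) (by linarith) (fun _ _ => le_rfl)
      simp only [cap, hu, if_true] at h2
      linarith
    · have h3 : ∑ v, (if s(u, v) ∈ M then 1 - a else 0) = 0 := by
        apply Finset.sum_eq_zero
        intro v _
        rw [if_neg]
        intro h
        exact hu ⟨_, h, by simp⟩
      simp only [cap, hu, if_false] at h2
      linarith
  have hdiag : ∀ u v, s(u, v) ∈ M ∪ B → G.Adj u v := by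
    intro u v h
    rcases Finset.mem_union.1 h with h | h
    · exact hM.1.1 _ h
    · exact (hBsub _ h).1
  have hK : ∀ K : Finset V, (1 - ε) * ∑ u ∈ K, ∑ v ∈ K, W u v ≤ 2 * ((K.card / 2 : ℕ) : ℝ) := by
    intro K
    refine class_bound ε lam _ hε0 hε1 hlamε K.card ?_ ?_
    · calc ∑ u ∈ K, ∑ v ∈ K, W u v ≤ ∑ u ∈ K, 1 := by
            apply Finset.sum_le_sum
            intro u _
            exact (Finset.sum_le_sum_of_subset_of_nonneg (Finset.subset_univ K)
              (fun v _ _ => hW0 u v)).trans (hrow u)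
        _ = K.card := by simp
    · have h1 := match_K hM.1 K
      have h2 := match_K hQ K
      have h3 : ∑ u ∈ K, ∑ v ∈ K, (if s(u, v) ∈ B then lam else 0) ≤
          lam * (K.card * (K.card - 1)) := by
        have : ∀ u ∈ K, ∑ v ∈ K, (if s(u, v) ∈ B then lam else 0) ≤ lam * (K.card - 1) := by
          intro u hu
          rw [← Finset.sum_erase_add K _ hu, if_neg (fun h => (hdiag u u
            (Finset.mem_union_right _ h)).ne rfl), add_zero]
          calc ∑ v ∈ K.erase u, (if s(u, v) ∈ B then lam else 0) ≤ ∑ v ∈ K.erase u, lam := by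
                apply Finset.sum_le_sum
                intro v _
                split_ifs <;> linarith
            _ = lam * (K.card - 1) := by
                rw [Finset.sum_const, Finset.card_erase_of_mem hu, nsmul_eq_mul,
                  Nat.cast_sub (Finset.card_pos.2 ⟨u, hu⟩)]
                push_cast; ring
        calc _ ≤ ∑ u ∈ K, lam * ((K.card : ℝ) - 1) := Finset.sum_le_sum this
          _ = _ := by rw [Finset.sum_const, nsmul_eq_mul]; ring
      have h4 : ∑ u ∈ K, ∑ v ∈ K, W u v ≤
          (1 - a) * ∑ u ∈ K, ∑ v ∈ K, (if s(u, v) ∈ M then (1 : ℝ) else 0) +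
          a * ∑ u ∈ K, ∑ v ∈ K, (if s(u, v) ∈ Q then (1 : ℝ) else 0) +
          ∑ u ∈ K, ∑ v ∈ K, (if s(u, v) ∈ B then lam else 0) := by
        simp only [Finset.mul_sum, ← Finset.sum_add_distrib]
        apply Finset.sum_le_sum
        intro u _
        apply Finset.sum_le_sum
        intro v _
        have := hdela u v
        simp only [W, X, mul_ite, mul_one, mul_zero]
        linarith
      have h5 := mul_le_mul_of_nonneg_left h1 (by linarith : 0 ≤ 1 - a)
      have h6 := mul_le_mul_of_nonneg_left h2 ha0.le
      linarith
  -- the fractional matching rounds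
  obtain ⟨N, hN, hNcard⟩ := upper (SimpleGraph.fromEdgeSet ((M ∪ B : Finset (Sym2 V)) : Set (Sym2 V))) W
    (1 - ε) (by linarith) (by linarith) hW0 (by
      intro u v h
      have hmem : s(u, v) ∈ M ∪ B := by
        by_contra hn
        rw [Finset.mem_union, not_or] at hn
        exact h (by simp [W, hn.1, hXB u v hn.2])
      rw [SimpleGraph.fromEdgeSet_adj]
      exact ⟨Finset.mem_coe.2 hmem, (hdiag _ _ hmem).ne⟩) hWsymm hrow hK
  have hNsub : N ⊆ M ∪ B := by
    intro e he
    have := hN.1 e he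
    rw [SimpleGraph.edgeSet_fromEdgeSet] at this
    exact Finset.mem_coe.1 this.1
  refine ⟨N, hNsub, ⟨fun e he => ?_, hN.2⟩, ?_⟩
  · have := hNsub he
    induction e with | _ x y
    exact hdiag x y this
  -- lower bound on the total weight
  obtain ⟨L, hL⟩ : ∃ L : ℝ, L = ∑ u, if Covered M u then ell u else 0 := ⟨_, rfl⟩
  have hL' : L = ∑ v, if Covered M v then 0 else ell v := by
    have e1 : ∀ u, (if Covered M u then ell u else 0) =
        ∑ v, if Covered M u then X u v else 0 := by
      intro u; split_ifs <;> simp [ell]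
    have e2 : ∀ v, (if Covered M v then 0 else ell v) =
        ∑ u, if Covered M v then 0 else X v u := by
      intro u; split_ifs <;> simp [ell]
    rw [hL]
    simp_rw [e1, e2]
    rw [Finset.sum_comm]
    apply Finset.sum_congr rfl
    intro v _
    apply Finset.sum_congr rfl
    intro u _
    by_cases h : s(u, v) ∈ B
    · have := hBxor u v h
      rw [hXsymm v u]
      by_cases hu : Covered M u
      · rw [if_pos hu, if_neg (this.1 hu)]
      · rw [if_neg hu, if_pos (by tauto)]
    · have h' : s(v, u) ∉ B := by rwa [Sym2.eq_swap]
      simp [hXB u v h, hXB v u h']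
  have htot : ∑ u, ∑ v, W u v = 2 * (1 - a) * M.card + 2 * L := by
    have e1 : ∑ u, ∑ v, W u v = ∑ u, ∑ v, (if s(u, v) ∈ M then 1 - a else 0) + ∑ u, ell u := by
      simp only [W, Finset.sum_add_distrib, ell]
    have e2 : ∑ u, ∑ v, (if s(u, v) ∈ M then 1 - a else 0) = 2 * (1 - a) * M.card := by
      have := pair_card M hM.1.not_diag
      rw [← Finset.sum_product', Finset.univ_product_univ, ← Finset.sum_filter, Finset.sum_const,
        nsmul_eq_mul, this]
      push_cast; ring
    have e3 : ∑ u, ell u = L + L := by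
      nth_rw 1 [hL]
      rw [hL', ← Finset.sum_add_distrib]
      apply Finset.sum_congr rfl
      intro u _
      split_ifs <;> simp
    rw [e1, e2, e3]; ring
  -- counting
  let P : Finset (V × V) := Finset.univ.filter fun p => s(p.1, p.2) ∈ N'
  let P1 := P.filter fun p => Covered M p.1
  let P2 := P.filter fun p => Covered M p.1 ∧ ¬ Covered M p.2
  have hPfst : ∀ p ∈ P, ∀ q ∈ P, p.1 = q.1 → p = q := by
    rintro ⟨u, v⟩ hp ⟨u', v'⟩ hq h
    simp only [P, Finset.mem_filter, Finset.mem_univ, true_and] at hp hq h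
    subst h
    rw [hN'.right_unique hp hq]
  have hPsnd : ∀ p ∈ P, ∀ q ∈ P, p.2 = q.2 → p = q := by
    rintro ⟨u, v⟩ hp ⟨u', v'⟩ hq h
    simp only [P, Finset.mem_filter, Finset.mem_univ, true_and] at hp hq h
    subst h
    rw [Sym2.eq_swap] at hp hq
    rw [hN'.right_unique hp hq]
  have hPcard : P.card = 2 * N'.card := pair_card N' hN'.not_diag
  have hP1 : P1.card ≤ 2 * M.card := by
    rw [← pair_card M hM.1.not_diag]
    have h1 : P1.card ≤ (Finset.univ.filter fun u => Covered M u).card := by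
      refine Finset.card_le_card_of_injOn Prod.fst ?_ ?_
      · intro p hp
        have := (Finset.mem_filter.1 (Finset.mem_coe.1 hp)).2
        simpa using this
      · intro p hp q hq h
        exact hPfst p (Finset.mem_filter.1 (Finset.mem_coe.1 hp)).1 q
          (Finset.mem_filter.1 (Finset.mem_coe.1 hq)).1 h
    refine h1.trans (Finset.card_le_card_of_surjOn Prod.fst ?_)
    intro u hu
    have hu' : Covered M u := by simpa using hu
    obtain ⟨e, he, v, rfl⟩ := hu'
    exact ⟨(u, v), by simpa using he, rfl⟩
  have hP2 : (P.filter fun p => ¬ Covered M p.1).card ≤ P2.card := by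
    refine Finset.card_le_card_of_injOn Prod.swap ?_ (Prod.swap_injective.injOn)
    rintro ⟨u, v⟩ hp
    simp only [P, P2, Finset.coe_filter, Finset.mem_filter, Finset.mem_univ, true_and,
      Set.mem_ofPred_eq, Prod.swap] at hp ⊢
    refine ⟨by rw [Sym2.eq_swap]; exact hp.1, no_uncovered_edge hM (hN'.1 _ hp.1) hp.2, hp.2⟩
  have hcount : 2 * N'.card ≤ 2 * M.card + P2.card := by
    have := Finset.card_filter_add_card_filter_not (s := P) (fun p => Covered M p.1)
    simp only [P1] at hP1
    omega
  have hsat : ∀ p ∈ P2, a ≤ ell p.1 + a * ell p.2 := by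
    rintro ⟨u, v⟩ hp
    simp only [P, P2, Finset.mem_filter, Finset.mem_univ, true_and] at hp
    obtain ⟨hp, hu, hv⟩ := hp
    have key : a ≤ ell u ∨ 1 ≤ ell v := by
      have hsum0 : ∀ w, 0 ≤ ∑ x, del w x := fun w => Finset.sum_nonneg fun x _ => hdel0 w x
      by_cases hB : s(u, v) ∈ B
      · have hmQ : s(u, v) ∈ Q := Finset.mem_inter.2 ⟨hB, hp⟩
        have h1 : del u v ≤ ∑ x, del u x :=
          Finset.single_le_sum (fun x _ => hdel0 u x) (Finset.mem_univ v)
        have h2 : del v u ≤ ∑ x, del v x :=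
          Finset.single_le_sum (fun x _ => hdel0 v x) (Finset.mem_univ u)
        rw [hdelsymm v u] at h2
        have h3 : del u v = min (rho u) (rho v) := by simp only [del, hmQ, if_true]
        rw [hell, hell]
        rcases min_choice (rho u) (rho v) with h | h
        · left
          rw [h3, h] at h1
          simp only [rho, cap, hu, if_true] at h1
          linarith
        · right
          rw [h3, h] at h2
          simp only [rho, cap, hv, if_false] at h2
          linarith
      · rcases hmax u v (hN'.1 _ hp) hu hv hB with h | h
        · left
          rw [hell, h, hak]
          linarith [hsum0 u]
        · right
          rw [hell, h, hlamC]
          linarith [hsum0 v]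
    have h1 := hell0 u
    have h2 := hell0 v
    simp only
    rcases key with h | h <;> nlinarith
  have hLlow : a * P2.card ≤ (1 + a) * L := by
    have h1 : ∑ p ∈ P2, ell p.1 ≤ L := by
      rw [hL, ← Finset.sum_filter, ← Finset.sum_image (f := ell) (s := P2) (g := Prod.fst)]
      · refine Finset.sum_le_sum_of_subset_of_nonneg ?_ (fun u _ _ => hell0 u)
        intro u hu
        obtain ⟨p, hp, rfl⟩ := Finset.mem_image.1 hu
        simpa using (Finset.mem_filter.1 hp).2.1
      · intro p hp q hq h
        exact hPfst p (Finset.mem_filter.1 (Finset.mem_coe.1 hp)).1 q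
          (Finset.mem_filter.1 (Finset.mem_coe.1 hq)).1 h
    have h2 : ∑ p ∈ P2, ell p.2 ≤ L := by
      have : L = ∑ v, if ¬ Covered M v then ell v else 0 := by
        rw [hL']
        apply Finset.sum_congr rfl
        intro v _
        split_ifs <;> rfl
      rw [this, ← Finset.sum_filter, ← Finset.sum_image (f := ell) (s := P2) (g := Prod.snd)]
      · refine Finset.sum_le_sum_of_subset_of_nonneg ?_ (fun u _ _ => hell0 u)
        intro u hu
        obtain ⟨p, hp, rfl⟩ := Finset.mem_image.1 hu
        simpa using (Finset.mem_filter.1 hp).2.2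
      · intro p hp q hq h
        exact hPsnd p (Finset.mem_filter.1 (Finset.mem_coe.1 hp)).1 q
          (Finset.mem_filter.1 (Finset.mem_coe.1 hq)).1 h
    have h3 : ∑ p ∈ P2, a ≤ ∑ p ∈ P2, (ell p.1 + a * ell p.2) := Finset.sum_le_sum hsat
    rw [Finset.sum_const, nsmul_eq_mul, Finset.sum_add_distrib, ← Finset.mul_sum] at h3
    have := mul_le_mul_of_nonneg_left h2 ha0.le
    linarith
  have hcount' : 2 * (N'.card : ℝ) - 2 * M.card ≤ P2.card := by
    have : 2 * (N'.card : ℝ) ≤ 2 * M.card + P2.card := by exact_mod_cast hcount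
    linarith
  refine final_arith ε b hε0 hε1 hb k C hk hC1 hC2 M.card N'.card L N.card (Nat.cast_nonneg _)
    (Nat.cast_nonneg _) ?_ ?_
  · rw [← ha]
    exact (mul_le_mul_of_nonneg_left hcount' ha0.le).trans hLlow
  · rw [← ha, ← htot]
    exact hNcard

/-- Let `0 < ε < 1`, `b = 1+√2`, `k ≥ 1/(bε³)` an integer, `M` a maximal matching of `G`,
and `B` a set of edges of the bipartite subgraph `H = G[V(M), V∖V(M)]` (each edge at most
once) with `deg_B(u) ≤ k` for `u ∈ V(M)`, `deg_B(v) ≤ ⌈kb⌉` for `v ∉ V(M)`, and every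
`H`-edge `(u,v) ∉ B` has `deg_B(u) = k` or `deg_B(v) = ⌈kb⌉`. Then `M ∪ B` contains a
matching of size at least `(1−ε)³·(2−√2)·μ(G)`. -/
theorem stmt8 {V : Type*} [Fintype V] [DecidableEq V]
    (ε b : ℝ) (hε0 : 0 < ε) (hε1 : ε < 1) (hb : b = 1 + Real.sqrt 2)
    (k : ℕ) (hk : (k : ℝ) ≥ 1 / (b * ε ^ 3))
    (G : SimpleGraph V) (M : Finset (Sym2 V)) (hM : IsMaximalMatching G M)
    (B : Finset (Sym2 V))
    (hBsub : ∀ e ∈ B, e ∈ G.edgeSet ∧ (∃ v ∈ e, Covered M v) ∧ (∃ v ∈ e, ¬ Covered M v))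
    (hcapA : ∀ u : V, Covered M u → degE B u ≤ k)
    (hcapB : ∀ v : V, ¬ Covered M v → degE B v ≤ ⌈(k : ℝ) * b⌉₊)
    (hmax : ∀ u v : V, G.Adj u v → Covered M u → ¬ Covered M v → s(u, v) ∉ B →
      degE B u = k ∨ degE B v = ⌈(k : ℝ) * b⌉₊) :
    ∃ N : Finset (Sym2 V), N ⊆ M ∪ B ∧ IsMatching G N ∧
      ∀ N' : Finset (Sym2 V), IsMatching G N' →
        (N.card : ℝ) ≥ (1 - ε) ^ 3 * (2 - Real.sqrt 2) * N'.card := by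
  classical
  obtain ⟨N, hN, hbest⟩ := Finset.exists_max_image
    ((M ∪ B).powerset.filter fun N : Finset (Sym2 V) => IsMatching G N) Finset.card
    ⟨∅, Finset.mem_filter.2 ⟨by simp, by simp [IsMatching]⟩⟩
  rw [Finset.mem_filter, Finset.mem_powerset] at hN
  refine ⟨N, hN.1, hN.2, fun N' hN' => ?_⟩
  obtain ⟨N₁, h1, h2, h3⟩ := core ε b hε0 hε1 hb k hk G M hM B hBsub hcapA hcapB hmax N' hN'
  have h4 : N₁.card ≤ N.card :=
    hbest N₁ (Finset.mem_filter.2 ⟨Finset.mem_powerset.2 h1, h2⟩)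
  exact h3.trans (by exact_mod_cast h4)
end

section
/- Fix positive integers q, n and a threshold T ∈ ℕ. For an initial load vector L : {1,…,q} → ℕ, consider the random process in which n independent steps are performed, each step picking an index in {1,…,q} uniformly at random and incrementing its load, and let τ(L) be the probability that after the n steps some index has load strictly greater than T. Let L be a load vector and let i, j be indices with L(i) ≥ L(j). Let L⁽¹⁾ be obtained from L by incrementing L(j) by one, and let L⁽²⁾ be obtained from L by incrementing L(i) by one. Then τ(L⁽²⁾) ≥ τ(L⁽¹⁾). -/
/-- `loadTau q n T L` is the probability, over `n` independent uniform picks of an index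
in `{1,…,q}` (each pick incrementing the load of the picked index), that some index ends
with load strictly greater than `T`, starting from the initial load vector `L`. Since the
picks are uniform, this probability equals the number of favourable outcomes
`f : Fin n → Fin q` divided by `q^n`. -/
noncomputable def loadTau (q n : ℕ) (T : ℕ) (L : Fin q → ℕ) : ℝ :=
  ((Finset.univ.filter fun f : Fin n → Fin q =>
      ∃ p : Fin q, T < L p + (Finset.univ.filter fun i : Fin n => f i = p).card).card : ℝ)
    / (q : ℝ) ^ n

/-- Recursive count of the favourable outcomes. -/
def loadCnt (q T : ℕ) : ℕ → (Fin q → ℕ) → ℕ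
  | 0, L => if ∃ p, T < L p then 1 else 0
  | n + 1, L => ∑ p, loadCnt q T n (L + Pi.single p 1)

theorem loadCnt_eq (q T n : ℕ) (L : Fin q → ℕ) :
    (Finset.univ.filter fun f : Fin n → Fin q =>
      ∃ p : Fin q, T < L p + (Finset.univ.filter fun i : Fin n => f i = p).card).card
      = loadCnt q T n L := by
  induction n generalizing L with
  | zero =>
    rw [Finset.card_filter]
    simp [loadCnt]
  | succ n ih =>
    simp only [loadCnt, ← ih]
    simp only [Finset.card_filter (fun f : Fin _ → Fin q => _)]
    rw [← (Fin.consEquiv (fun _ : Fin (n + 1) => Fin q)).sum_comp, Fintype.sum_prod_type]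
    refine Finset.sum_congr rfl fun p _ => Finset.sum_congr rfl fun f _ => ?_
    have h : ∀ x : Fin q, L x + (Finset.univ.filter fun i : Fin (n + 1) =>
        (Fin.consEquiv (fun _ : Fin (n + 1) => Fin q)) (p, f) i = x).card
        = (L + Pi.single p 1 : Fin q → ℕ) x + (Finset.univ.filter fun i : Fin n => f i = x).card := by
      intro x
      rw [Finset.card_filter, Finset.card_filter, Fin.sum_univ_succ]
      have h0 : (Fin.consEquiv (fun _ : Fin (n + 1) => Fin q)) (p, f) 0 = p := rfl
      have h1 : ∀ k : Fin n,
          (Fin.consEquiv (fun _ : Fin (n + 1) => Fin q)) (p, f) k.succ = f k := fun _ => rfl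
      simp only [h0, h1, Pi.add_apply, Pi.single_apply, eq_comm (a := x), add_assoc]
    simp only [h]

theorem loadCnt_perm (q T n : ℕ) (L : Fin q → ℕ) (σ : Equiv.Perm (Fin q)) :
    loadCnt q T n (L ∘ σ) = loadCnt q T n L := by
  induction n generalizing L with
  | zero =>
    have : (∃ p, T < (L ∘ σ) p) ↔ ∃ p, T < L p :=
      (σ.surjective.exists (p := fun p => T < L p)).symm
    simp only [loadCnt, this]
  | succ n ih =>
    simp only [loadCnt]
    refine Eq.trans ?_ (Equiv.sum_comp σ (fun p => loadCnt q T n (L + Pi.single p 1)))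
    refine Finset.sum_congr rfl fun p _ => ?_
    rw [← ih (L + Pi.single (σ p) 1)]
    congr 1
    ext x
    simp [Pi.single_apply]

theorem loadCnt_le (q T n : ℕ) (L : Fin q → ℕ) (i j : Fin q) (hij : L j ≤ L i) :
    loadCnt q T n (L + Pi.single j 1) ≤ loadCnt q T n (L + Pi.single i 1) := by
  rcases hij.eq_or_lt with h | h
  · apply le_of_eq
    rw [← loadCnt_perm q T n (L + Pi.single i 1) (Equiv.swap i j)]
    congr 1
    ext x
    simp only [Pi.add_apply, Function.comp, Pi.single_apply, Equiv.swap_apply_def]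
    grind
  induction n generalizing L with
  | zero =>
    have : (∃ p, T < (L + Pi.single j 1 : Fin q → ℕ) p) → ∃ p, T < (L + Pi.single i 1 : Fin q → ℕ) p := by
      rintro ⟨p, hp⟩
      by_cases hpj : p = j
      · refine ⟨i, ?_⟩
        subst hpj
        simp at hp ⊢
        omega
      · refine ⟨p, ?_⟩
        simp [hpj] at hp ⊢
        omega
    simp only [loadCnt]
    split_ifs with h1 h2
    · exact le_rfl
    · exact absurd (this h1) h2
    · exact Nat.zero_le _
    · exact le_rfl
  | succ n ih =>
    simp only [loadCnt]
    refine Finset.sum_le_sum fun p _ => ?_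
    rw [add_right_comm L (Pi.single j 1), add_right_comm L (Pi.single i 1)]
    have hle : (L + Pi.single p 1 : Fin q → ℕ) j ≤ (L + Pi.single p 1 : Fin q → ℕ) i := by
      simp only [Pi.add_apply, Pi.single_apply]
      split_ifs <;> omega
    rcases hle.eq_or_lt with h' | h'
    · apply le_of_eq
      rw [← loadCnt_perm q T n (L + Pi.single p 1 + Pi.single i 1) (Equiv.swap i j)]
      congr 1
      ext x
      simp only [Pi.add_apply, Function.comp, Pi.single_apply, Equiv.swap_apply_def] at h' ⊢
      grind
    · exact ih _ hle h'

/-- Let `L` be a load vector and `i, j` indices with `L(i) ≥ L(j)`. If `L⁽¹⁾` increments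
`L(j)` and `L⁽²⁾` increments `L(i)`, then `τ(L⁽²⁾) ≥ τ(L⁽¹⁾)`. -/
theorem stmt9 (q n : ℕ) (hq : 0 < q) (hn : 0 < n) (T : ℕ)
    (L : Fin q → ℕ) (i j : Fin q) (hij : L j ≤ L i) :
    loadTau q n T (Function.update L j (L j + 1))
      ≤ loadTau q n T (Function.update L i (L i + 1)) := by
  have hu : ∀ k : Fin q, Function.update L k (L k + 1) = L + Pi.single k 1 := by
    intro k
    ext x
    simp only [Function.update_apply, Pi.add_apply, Pi.single_apply]
    split_ifs with h <;> simp [h]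
  unfold loadTau
  rw [loadCnt_eq, loadCnt_eq, hu, hu]
  have := loadCnt_le q T n L i j hij
  gcongr
end

section
/- Let 0 < ε < 1, let b = 1 + √2, let k be an integer with k ≥ 1/(bε³), let G be a graph, let M be a maximal matching of G, and let H = G[V(M), V\V(M)]. Let B ⊆ E(H) be a b-matching with capacities k on V(M) and ⌈kb⌉ on V\V(M) such that every edge (u,v) ∈ E(H)\B with u ∈ V(M), v ∉ V(M) satisfies deg_B(u) = k or deg_B(v) = ⌈kb⌉. Let M* be a maximum matching of G, let M*_1 = M* ∩ (V(M) × (V\V(M))) and M*_2 = M* ∩ (V(M) × V(M)). Then there exists a fractional matching x supported on M ∪ B with x_e ≤ 1 − 1/b for e ∈ M, x_e ≤ 1/b for e ∈ B ∩ M*_1, and x_e ≤ ε³ for all other edges, such that Σ_{e∈M} x_e ≥ (1 − 1/b)(|M*_2| + |M*_1|/2) and Σ_{e∈B} x_e ≥ (1 − ε)·(1/(b+1))·|M*_1|. -/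
/-- Counting: `2|M₂| + |M₁| ≤ 2|M|`. -/
lemma card_aux {V : Type*} [Fintype V] [DecidableEq V] (G : SimpleGraph V)
    (M Mstar M1 M2 : Finset (Sym2 V)) (hMstar : IsMatching G Mstar)
    (hM1 : M1 = Mstar.filter fun e => (∃ v ∈ e, Covered M v) ∧ ∃ v ∈ e, ¬ Covered M v)
    (hM2 : M2 = Mstar.filter fun e => ∀ v ∈ e, Covered M v) :
    2 * M2.card + M1.card ≤ 2 * M.card := by
  classical
  let C : Finset V := Finset.univ.filter (Covered M)
  have hC : C.card ≤ 2 * M.card := by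
    have h1 : C ⊆ M.biUnion (fun e => e.toFinset) := by
      intro v hv
      obtain ⟨e, he, hve⟩ := (Finset.mem_filter.1 hv).2
      exact Finset.mem_biUnion.2 ⟨e, he, by simpa using hve⟩
    calc C.card ≤ _ := Finset.card_le_card h1
      _ ≤ ∑ e ∈ M, e.toFinset.card := Finset.card_biUnion_le
      _ ≤ ∑ e ∈ M, 2 := by
        apply Finset.sum_le_sum
        intro e _
        rw [Sym2.card_toFinset]
        split_ifs <;> simp
      _ = 2 * M.card := by simp [mul_comm]
  have hdisj : Disjoint M2 M1 := by
    rw [Finset.disjoint_left]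
    intro e h2 h1
    rw [hM2, Finset.mem_filter] at h2
    rw [hM1, Finset.mem_filter] at h1
    obtain ⟨v, hv, hn⟩ := h1.2.2
    exact hn (h2.2 v hv)
  have hsub : ∀ e ∈ M2 ∪ M1, e ∈ Mstar := by
    intro e he
    rw [Finset.mem_union] at he
    rcases he with he | he
    · rw [hM2] at he; exact (Finset.mem_filter.1 he).1
    · rw [hM1] at he; exact (Finset.mem_filter.1 he).1
  have hcard : ((M2 ∪ M1).biUnion (fun e => e.toFinset ∩ C)).card
      = ∑ e ∈ M2 ∪ M1, (e.toFinset ∩ C).card := by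
    apply Finset.card_biUnion
    intro e he f hf hef
    refine Finset.disjoint_left.2 ?_
    intro v hv hv'
    simp only [Finset.mem_inter, Sym2.mem_toFinset] at hv hv'
    exact hMstar.2 e (hsub e he) f (hsub f hf) hef v hv.1 hv'.1
  have hle : ((M2 ∪ M1).biUnion (fun e => e.toFinset ∩ C)).card ≤ C.card := by
    apply Finset.card_le_card
    intro v hv
    obtain ⟨e, _, h⟩ := Finset.mem_biUnion.1 hv
    exact (Finset.mem_inter.1 h).2
  rw [hcard, Finset.sum_union hdisj] at hle
  have h2 : ∑ e ∈ M2, 2 ≤ ∑ e ∈ M2, (e.toFinset ∩ C).card := by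
    apply Finset.sum_le_sum
    intro e he
    have he' := hsub e (Finset.mem_union_left _ he)
    have hnd : ¬ e.IsDiag := G.not_isDiag_of_mem_edgeSet (hMstar.1 e he')
    have : e.toFinset ∩ C = e.toFinset := by
      rw [Finset.inter_eq_left]
      intro v hv
      rw [hM2, Finset.mem_filter] at he
      exact Finset.mem_filter.2 ⟨Finset.mem_univ _, he.2 v (by simpa using hv)⟩
    rw [this, Sym2.card_toFinset_of_not_isDiag e hnd]
  have h1 : ∑ e ∈ M1, 1 ≤ ∑ e ∈ M1, (e.toFinset ∩ C).card := by
    apply Finset.sum_le_sum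
    intro e he
    rw [hM1, Finset.mem_filter] at he
    obtain ⟨v, hv, hc⟩ := he.2.1
    exact Finset.card_pos.2 ⟨v, by simp [hv, C, hc]⟩
  simp at h1 h2
  omega

/-- Let `0 < ε < 1`, `b = 1+√2`, `k ≥ 1/(bε³)` an integer, `M` a maximal matching of `G`,
and `B ⊆ E(H)` a maximal `b`-matching of `H = G[V(M), V∖V(M)]` with capacities `k` on
`V(M)` and `⌈kb⌉` on `V∖V(M)`. Let `M*` be a maximum matching of `G`, with `M*₁` its edges
having exactly one endpoint in `V(M)` and `M*₂` those with both endpoints in `V(M)`.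
Then there is a fractional matching `x` supported on `M ∪ B` with `x_e ≤ 1 − 1/b` on `M`,
`x_e ≤ 1/b` on `B ∩ M*₁`, `x_e ≤ ε³` elsewhere, `Σ_{e∈M} x_e ≥ (1−1/b)(|M*₂| + |M*₁|/2)`,
and `Σ_{e∈B} x_e ≥ (1−ε)·(1/(b+1))·|M*₁|`. -/
theorem stmt13 {V : Type*} [Fintype V] [DecidableEq V]
    (ε b : ℝ) (hε0 : 0 < ε) (hε1 : ε < 1) (hb : b = 1 + Real.sqrt 2)
    (k : ℕ) (hk : (k : ℝ) ≥ 1 / (b * ε ^ 3))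
    (G : SimpleGraph V) [DecidableRel G.Adj]
    (M : Finset (Sym2 V)) (hM : IsMaximalMatching G M)
    (B : Finset (Sym2 V))
    (hBsub : ∀ e ∈ B, e ∈ G.edgeSet ∧ (∃ v ∈ e, Covered M v) ∧ (∃ v ∈ e, ¬ Covered M v))
    (hcapA : ∀ u : V, Covered M u → degE B u ≤ k)
    (hcapB : ∀ v : V, ¬ Covered M v → degE B v ≤ ⌈(k : ℝ) * b⌉₊)
    (hmax : ∀ u v : V, G.Adj u v → Covered M u → ¬ Covered M v → s(u, v) ∉ B →
      degE B u = k ∨ degE B v = ⌈(k : ℝ) * b⌉₊)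
    (Mstar : Finset (Sym2 V)) (hMstar : IsMatching G Mstar)
    (hMstarMax : ∀ N : Finset (Sym2 V), IsMatching G N → N.card ≤ Mstar.card)
    (M1 M2 : Finset (Sym2 V))
    (hM1 : M1 = Mstar.filter fun e => (∃ v ∈ e, Covered M v) ∧ ∃ v ∈ e, ¬ Covered M v)
    (hM2 : M2 = Mstar.filter fun e => ∀ v ∈ e, Covered M v) :
    ∃ x : Sym2 V → ℝ,
      IsFracMatching G x ∧
      (∀ e : Sym2 V, e ∉ M ∪ B → x e = 0) ∧
      (∀ e ∈ M, x e ≤ 1 - 1 / b) ∧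
      (∀ e ∈ B ∩ M1, x e ≤ 1 / b) ∧
      (∀ e : Sym2 V, e ∉ M → e ∉ B ∩ M1 → x e ≤ ε ^ 3) ∧
      (∑ e ∈ M, x e ≥ (1 - 1 / b) * ((M2.card : ℝ) + (M1.card : ℝ) / 2)) ∧
      (∑ e ∈ B, x e ≥ (1 - ε) * (1 / (b + 1)) * (M1.card : ℝ)) := by
  classical
  have hs : Real.sqrt 2 ^ 2 = 2 := Real.sq_sqrt (by norm_num)
  have hs0 : 0 ≤ Real.sqrt 2 := Real.sqrt_nonneg 2
  have hb1 : 1 < b := by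
    have : 0 < Real.sqrt 2 := by positivity
    linarith
  have hb0 : 0 < b := by linarith
  have hbi1 : 1 / b ≤ 1 := by rw [div_le_one hb0]; exact hb1.le
  have hbi0 : 0 < 1 / b := by positivity
  have he3 : 0 < ε ^ 3 := by positivity
  have hk0 : (0 : ℝ) < k := lt_of_lt_of_le (by positivity) hk
  have hkb : 0 < (k : ℝ) * b := by positivity
  have hkb3 : 1 ≤ k * b * ε ^ 3 := by
    have := (div_le_iff₀ (by positivity : 0 < b * ε ^ 3)).1 hk
    linarith
  obtain ⟨K, hK⟩ : ∃ K : ℕ, K = ⌈(k : ℝ) * b⌉₊ := ⟨_, rfl⟩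
  rw [← hK] at hmax hcapB
  have hKge : (k : ℝ) * b ≤ K := by rw [hK]; exact Nat.le_ceil _
  have hKle : (K : ℝ) ≤ k * b + 1 := by rw [hK]; exact (Nat.ceil_lt_add_one hkb.le).le
  have hK0 : (0 : ℝ) < K := by linarith
  obtain ⟨δ, hδ⟩ : ∃ δ : ℝ, δ = 1 / K := ⟨_, rfl⟩
  have hδ0 : 0 < δ := by rw [hδ]; positivity
  have hδK : δ * K = 1 := by rw [hδ]; field_simp
  have hδ3 : δ ≤ ε ^ 3 := by
    rw [hδ, div_le_iff₀ hK0]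
    nlinarith
  have hδk : δ * k ≤ 1 / b := by
    rw [hδ, le_div_iff₀ hb0, one_div, mul_assoc, inv_mul_le_iff₀ hK0]
    linarith
  have hε3 : ε ^ 3 ≤ ε := by
    have := pow_le_pow_of_le_one hε0.le hε1.le (show 1 ≤ 3 by norm_num)
    simpa using this
  have hδk2 : (1 - ε) / b ≤ δ * k := by
    rw [hδ, div_le_iff₀ hb0, one_div, mul_assoc, inv_mul_eq_div, le_div_iff₀ hK0]
    have h1 : 1 ≤ k * b * ε := hkb3.trans (mul_le_mul_of_nonneg_left hε3 hkb.le)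
    nlinarith
  -- capacities and weights
  let cap : V → ℝ := fun v => if Covered M v then 1 / b else 1
  let w : V → ℝ := fun v => if Covered M v then b / (b + 1) else 1 / (b + 1)
  have hw0 : ∀ v, 0 ≤ w v := by
    intro v; simp only [w]; split_ifs <;> positivity
  have hwcap : ∀ v, w v * cap v = 1 / (b + 1) := by
    intro v; simp only [w, cap]; split_ifs
    · field_simp
    · simp
  have hcap1 : ∀ v, cap v ≤ 1 := by
    intro v; simp only [cap]; split_ifs
    · exact hbi1
    · exact le_rfl
  have hslack : ∀ v, 0 ≤ cap v - δ * degE B v := by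
    intro v
    simp only [cap]; split_ifs with h
    · have : (degE B v : ℝ) ≤ k := by exact_mod_cast hcapA v h
      nlinarith
    · have : (degE B v : ℝ) ≤ K := by exact_mod_cast hcapB v h
      nlinarith
  have hex : ∀ e : Sym2 V, ∃ t : ℝ, (∀ v ∈ e, t ≤ cap v - δ * degE B v) ∧
      ∃ v ∈ e, t = cap v - δ * degE B v := by
    intro e
    induction e using Sym2.ind with
    | _ a c =>
      rcases le_total (cap a - δ * degE B a) (cap c - δ * degE B c) with h | h
      · exact ⟨_, by simp; linarith, a, by simp, rfl⟩
      · exact ⟨_, by simp; linarith, c, by simp, rfl⟩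
  choose t ht1 ht2 using hex
  have ht0 : ∀ e, 0 ≤ t e := by
    intro e
    obtain ⟨v, _, h⟩ := ht2 e
    rw [h]; exact hslack v
  let z : Sym2 V → ℝ := fun e => if e ∈ M1 then t e else 0
  have hz0 : ∀ e, 0 ≤ z e := by
    intro e; simp only [z]; split_ifs
    · exact ht0 e
    · exact le_rfl
  let y : Sym2 V → ℝ := fun e => δ + z e
  have hy0 : ∀ e, 0 ≤ y e := fun e => add_nonneg hδ0.le (hz0 e)
  let D : V → ℝ := fun v => ∑ e ∈ B.filter (fun e => v ∈ e), y e
  have hDz : ∀ v, D v = δ * degE B v + ∑ e ∈ B.filter (fun e => v ∈ e), z e := by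
    intro v
    simp only [D, y, Finset.sum_add_distrib, Finset.sum_const, nsmul_eq_mul, degE]
    ring
  have hDlow : ∀ v, δ * degE B v ≤ D v := by
    intro v
    rw [hDz]
    have : 0 ≤ ∑ e ∈ B.filter (fun e => v ∈ e), z e := Finset.sum_nonneg fun e _ => hz0 e
    linarith
  have hM1sub : ∀ e ∈ M1, e ∈ Mstar := by
    intro e he; rw [hM1] at he; exact (Finset.mem_filter.1 he).1
  have hDt : ∀ e ∈ B, e ∈ M1 → ∀ v ∈ e, D v = δ * degE B v + t e := by
    intro e heB he1 v hv
    rw [hDz, Finset.sum_eq_single e]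
    · simp [z, he1]
    · intro f hf hfe
      have hf' := (Finset.mem_filter.1 hf).2
      have : f ∉ M1 := fun hf1 =>
        hMstar.2 f (hM1sub f hf1) e (hM1sub e he1) hfe v hf' hv
      simp [z, this]
    · intro h; exact absurd (Finset.mem_filter.2 ⟨heB, hv⟩) h
  have hDcap : ∀ v, D v ≤ cap v := by
    intro v
    by_cases h : ∃ e ∈ B, e ∈ M1 ∧ v ∈ e
    · obtain ⟨e, heB, he1, hv⟩ := h
      rw [hDt e heB he1 v hv]
      have := ht1 e v hv
      linarith
    · rw [hDz, Finset.sum_eq_zero]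
      · have := hslack v
        linarith
      · intro e he
        have he' := Finset.mem_filter.1 he
        have : e ∉ M1 := fun h1 => h ⟨e, he'.1, h1, he'.2⟩
        simp [z, this]
  have hyD : ∀ e ∈ B, ∀ v ∈ e, y e ≤ D v := by
    intro e he v hv
    exact Finset.single_le_sum (f := y) (fun f _ => hy0 f) (Finset.mem_filter.2 ⟨he, hv⟩)
  have hBM : ∀ e ∈ B, e ∉ M := by
    intro e he heM
    obtain ⟨v, hv, hn⟩ := (hBsub e he).2.2
    exact hn ⟨e, heM, hv⟩
  have hyb : ∀ e ∈ B, y e ≤ 1 / b := by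
    intro e he
    obtain ⟨v, hv, hc⟩ := (hBsub e he).2.1
    have h1 := (hyD e he v hv).trans (hDcap v)
    simpa only [cap, if_pos hc] using h1
  let x : Sym2 V → ℝ := fun e => if e ∈ M then 1 - 1 / b else if e ∈ B then y e else 0
  have hxM : ∀ e ∈ M, x e = 1 - 1 / b := by
    intro e he; simp only [x, if_pos he]
  have hxB : ∀ e ∈ B, x e = y e := by
    intro e he; simp only [x, if_neg (hBM e he), if_pos he]
  have hx0 : ∀ e, e ∉ M → e ∉ B → x e = 0 := by
    intro e h1 h2; simp only [x, if_neg h1, if_neg h2]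
  have hxsum : ∀ v, ∑ e ∈ G.edgeFinset.filter (fun e => v ∈ e), x e ≤
      ∑ e ∈ M.filter (fun e => v ∈ e), (1 - 1 / b) + D v := by
    intro v
    have h1 : ∑ e ∈ G.edgeFinset.filter (fun e => v ∈ e), x e =
        ∑ e ∈ (M.filter (fun e => v ∈ e)) ∪ (B.filter (fun e => v ∈ e)), x e := by
      symm
      apply Finset.sum_subset
      · intro e he
        simp only [Finset.mem_union, Finset.mem_filter, SimpleGraph.mem_edgeFinset] at he ⊢
        rcases he with he | he
        · exact ⟨hM.1.1 e he.1, he.2⟩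
        · exact ⟨(hBsub e he.1).1, he.2⟩
      · intro e he hn
        simp only [Finset.mem_union, Finset.mem_filter] at he hn
        apply hx0
        · intro h; exact hn (Or.inl ⟨h, he.2⟩)
        · intro h; exact hn (Or.inr ⟨h, he.2⟩)
    rw [h1, Finset.sum_union]
    · apply le_of_eq
      congr 1
      · exact Finset.sum_congr rfl fun e he => hxM e (Finset.mem_filter.1 he).1
      · exact Finset.sum_congr rfl fun e he => hxB e (Finset.mem_filter.1 he).1
    · rw [Finset.disjoint_left]
      intro e h h'
      exact hBM e (Finset.mem_filter.1 h').1 (Finset.mem_filter.1 h).1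
  refine ⟨x, ⟨?_, ?_⟩, ?_, ?_, ?_, ?_, ?_, ?_⟩
  · intro e _
    by_cases h : e ∈ M
    · rw [hxM e h]; constructor <;> linarith
    · by_cases h' : e ∈ B
      · rw [hxB e h']; exact ⟨hy0 e, (hyb e h').trans hbi1⟩
      · rw [hx0 e h h']; norm_num
  · intro v
    refine (hxsum v).trans ?_
    have hD := hDcap v
    by_cases hc : Covered M v
    · have hcard : (M.filter (fun e => v ∈ e)).card ≤ 1 := by
        rw [Finset.card_le_one]
        intro e he f hf
        by_contra hef
        rw [Finset.mem_filter] at he hf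
        exact hM.1.2 e he.1 f hf.1 hef v he.2 hf.2
      have hcard' : ((M.filter (fun e => v ∈ e)).card : ℝ) ≤ 1 := by exact_mod_cast hcard
      simp only [cap, if_pos hc] at hD
      rw [Finset.sum_const, nsmul_eq_mul]
      nlinarith
    · have : M.filter (fun e => v ∈ e) = ∅ := by
        rw [Finset.filter_eq_empty_iff]
        intro e he hv
        exact hc ⟨e, he, hv⟩
      rw [this, Finset.sum_empty, zero_add]
      exact hD.trans (hcap1 v)
  · intro e he
    rw [Finset.mem_union, not_or] at he
    exact hx0 e he.1 he.2
  · intro e he; exact (hxM e he).le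
  · intro e he
    rw [Finset.mem_inter] at he
    rw [hxB e he.1]; exact hyb e he.1
  · intro e h1 h2
    by_cases h : e ∈ B
    · have : e ∉ M1 := fun h' => h2 (Finset.mem_inter.2 ⟨h, h'⟩)
      rw [hxB e h]
      simp only [y, z, if_neg this, add_zero]
      exact hδ3
    · rw [hx0 e h1 h]; exact he3.le
  · rw [Finset.sum_congr rfl hxM, Finset.sum_const, nsmul_eq_mul]
    have h := card_aux G M Mstar M1 M2 hMstar hM1 hM2
    have h' : 2 * (M2.card : ℝ) + M1.card ≤ 2 * M.card := by exact_mod_cast h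
    have : (M2.card : ℝ) + (M1.card : ℝ) / 2 ≤ M.card := by linarith
    rw [mul_comm (M.card : ℝ)]
    exact mul_le_mul_of_nonneg_left this (by linarith)
  · rw [Finset.sum_congr rfl hxB]
    have hgood : ∀ e ∈ M1, ∃ v ∈ e, (1 - ε) * (1 / (b + 1)) ≤ w v * D v := by
      intro e he
      have hp : 0 < 1 / (b + 1) := by positivity
      by_cases hB : e ∈ B
      · obtain ⟨v, hv, hvt⟩ := ht2 e
        refine ⟨v, hv, ?_⟩
        rw [hDt e hB he v hv, hvt, add_sub_cancel, hwcap]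
        nlinarith
      · have he' := he
        rw [hM1, Finset.mem_filter] at he'
        obtain ⟨hes, ⟨u, hu, huc⟩, ⟨v, hv, hvc⟩⟩ := he'
        have huv : u ≠ v := fun h => hvc (h ▸ huc)
        have hee : e = s(u, v) := (Sym2.mem_and_mem_iff huv).1 ⟨hu, hv⟩
        have hadj : G.Adj u v := by
          have := hMstar.1 e hes
          rwa [hee, SimpleGraph.mem_edgeSet] at this
        rcases hmax u v hadj huc hvc (hee ▸ hB) with h | h
        · refine ⟨u, hu, ?_⟩
          have h1 := hDlow u
          rw [h] at h1
          have h2 : (1 - ε) / b ≤ D u := hδk2.trans h1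
          refine le_trans (le_of_eq ?_) (mul_le_mul_of_nonneg_left h2 (hw0 u))
          simp only [w, if_pos huc]
          field_simp
        · refine ⟨v, hv, ?_⟩
          have h1 := hDlow v
          rw [h, hδK] at h1
          refine le_trans ?_ (mul_le_mul_of_nonneg_left h1 (hw0 v))
          simp only [w, if_neg hvc]
          nlinarith
    have hgood' : ∀ e : Sym2 V, ∃ v, e ∈ M1 →
        v ∈ e ∧ (1 - ε) * (1 / (b + 1)) ≤ w v * D v := by
      intro e
      by_cases he : e ∈ M1
      · obtain ⟨v, h⟩ := hgood e he
        exact ⟨v, fun _ => h⟩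
      · exact ⟨e.out.1, fun h => absurd h he⟩
    choose f hf using hgood'
    have hf1 : ∀ e ∈ M1, f e ∈ e := fun e he => (hf e he).1
    have hf2 : ∀ e ∈ M1, (1 - ε) * (1 / (b + 1)) ≤ w (f e) * D (f e) :=
      fun e he => (hf e he).2
    have hinj : Set.InjOn f (M1 : Set (Sym2 V)) := by
      intro e he e' he' hee
      by_contra hne
      exact hMstar.2 e (hM1sub e he) e' (hM1sub e' he') hne (f e) (hf1 e he)
        (hee ▸ hf1 e' he')
    have hD0 : ∀ v, 0 ≤ D v := fun v => Finset.sum_nonneg fun e _ => hy0 e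
    have hlow : (1 - ε) * (1 / (b + 1)) * (M1.card : ℝ) ≤ ∑ v, w v * D v := by
      calc (1 - ε) * (1 / (b + 1)) * (M1.card : ℝ)
          = ∑ e ∈ M1, (1 - ε) * (1 / (b + 1)) := by
            rw [Finset.sum_const, nsmul_eq_mul, mul_comm]
        _ ≤ ∑ e ∈ M1, w (f e) * D (f e) := Finset.sum_le_sum hf2
        _ = ∑ v ∈ M1.image f, w v * D v := (Finset.sum_image (f := fun v => w v * D v) hinj).symm
        _ ≤ ∑ v, w v * D v :=
            Finset.sum_le_sum_of_subset_of_nonneg (Finset.subset_univ _)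
              fun v _ _ => mul_nonneg (hw0 v) (hD0 v)
    refine le_trans hlow (le_of_eq ?_)
    simp only [D, Finset.mul_sum, Finset.sum_filter]
    rw [Finset.sum_comm]
    apply Finset.sum_congr rfl
    intro e he
    obtain ⟨-, ⟨u, hu, huc⟩, ⟨v, hv, hvc⟩⟩ := hBsub e he
    have huv : u ≠ v := fun h => hvc (h ▸ huc)
    have hee : e = s(u, v) := (Sym2.mem_and_mem_iff huv).1 ⟨hu, hv⟩
    have hfilt : (Finset.univ.filter fun a => a ∈ e) = {u, v} := by
      ext a; simp [hee]
    have : ∑ a, w a * (if a ∈ e then y e else 0) = ∑ a ∈ {u, v}, w a * y e := by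
      rw [← hfilt, Finset.sum_filter]
      apply Finset.sum_congr rfl
      intro a _
      split_ifs <;> simp
    rw [this, Finset.sum_pair huv]
    simp only [w, if_pos huc, if_neg hvc]
    field_simp
end
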